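/- arXiv:2502.16462 — 5 statements merged into one kernel-verified Lean document; each statement's English description precedes it below -/
import Mathlib

section
/- There exist universal constants Č ≥ 1 and č > 0 such that: for any finite point set X = {x_1,...,x_m} ⊆ X of size m, any hypothesis class H ⊆ {-1,1}^X, any 0 < ε < 1, any 0 < α < 1/2 and any 0 < γ ≤ 1, if fat_{č·α·ε·γ}(Δ(H)_⌈γ⌉) ≤ m, then, writing d = fat_{č·α·ε·γ}(Δ(H)_⌈γ⌉), it holds that ln N_∞(X, Δ(H)_⌈γ⌉, α·γ) ≤ Č · d · ln^{1+ε}( 2m/(d·α) ). -/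
open MeasureTheory
open scoped ENNReal

/-- The truncated natural logarithm `Ln(x) = ln(max(x, e))`. -/
noncomputable def Ln (x : ℝ) : ℝ := Real.log (max x (Real.exp 1))

/-- `func(x) = Ln(x) · Ln(Ln(x))²`. -/
noncomputable def func (x : ℝ) : ℝ := Ln x * (Ln (Ln x)) ^ 2

/-- The set `Δ(H)` of voting classifiers over `H`: all finite convex combinations
`f = ∑ i, α i • h i` with `h i ∈ H`, `α i > 0` and `∑ i, α i = 1`. -/
def votingClassifiers {X : Type*} (H : Set (X → ℝ)) : Set (X → ℝ) :=
  {f | ∃ (n : ℕ) (a : Fin n → ℝ) (h : Fin n → (X → ℝ)),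
    (∀ i, h i ∈ H) ∧ (∀ i, 0 < a i) ∧ (∑ i, a i) = 1 ∧
    f = fun x => ∑ i, a i * h i x}

/-- `H` realizes all ±1 labelings on the finite point set `s`. -/
def ShattersPM {X : Type*} (H : Set (X → ℝ)) (s : Finset X) : Prop :=
  ∀ b : X → ℝ, (∀ x, b x = 1 ∨ b x = -1) → ∃ h ∈ H, ∀ x ∈ s, h x = b x

/-- `H` has VC-dimension exactly `d`: some set of `d` points is shattered and every
shattered set has at most `d` points. -/
def HasVCDim {X : Type*} (H : Set (X → ℝ)) (d : ℕ) : Prop :=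
  (∃ s : Finset X, ShattersPM H s ∧ s.card = d) ∧
    ∀ s : Finset X, ShattersPM H s → s.card ≤ d

/-- Clipping of `f` at level `γ`. -/
noncomputable def clip {X : Type*} (γ : ℝ) (f : X → ℝ) : X → ℝ :=
  fun x => if γ < f x then γ else if f x < -γ then -γ else f x

/-- The clipped class `F_⌈γ⌉`. -/
def clipClass {X : Type*} (F : Set (X → ℝ)) (γ : ℝ) : Set (X → ℝ) := clip γ '' F

/-- `N` is an `α`-cover of `F` in `ℓ_∞` on the point set `xs`. -/
def IsCoverOn {X : Type*} {m : ℕ} (xs : Fin m → X) (F : Set (X → ℝ)) (α : ℝ)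
    (N : Finset (X → ℝ)) : Prop :=
  ∀ f ∈ F, ∃ f' ∈ N, ∀ i, |f (xs i) - f' (xs i)| ≤ α

/-- The `ℓ_∞` covering number `N_∞(xs, F, α)` (as an extended nonneg. real, `⊤` if no
finite cover exists). -/
noncomputable def coveringNumber {X : Type*} {m : ℕ} (xs : Fin m → X) (F : Set (X → ℝ))
    (α : ℝ) : ℝ≥0∞ :=
  ⨅ (N : Finset (X → ℝ)) (_ : IsCoverOn xs F α N), (N.card : ℝ≥0∞)

/-- `F` β-shatters the points `x` with witness levels `r`. -/
def FatShattersWith {X : Type*} (F : Set (X → ℝ)) (β : ℝ) {n : ℕ}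
    (x : Fin n → X) (r : Fin n → ℝ) : Prop :=
  ∀ b : Fin n → Bool, ∃ f ∈ F, ∀ i,
    (b i = true → r i + β ≤ f (x i)) ∧ (b i = false → f (x i) ≤ r i - β)

/-- `F` β-shatters some set of `n` points. -/
def FatShatters {X : Type*} (F : Set (X → ℝ)) (β : ℝ) (n : ℕ) : Prop :=
  ∃ (x : Fin n → X) (r : Fin n → ℝ), FatShattersWith F β x r

/-- The fat-shattering dimension `fat_β(F)` as an extended natural number. -/
noncomputable def fatDim {X : Type*} (F : Set (X → ℝ)) (β : ℝ) : ℕ∞ :=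
  ⨆ (n : ℕ) (_ : FatShatters F β n), (n : ℕ∞)

/-- The γ-margin loss `L_D^γ(f) = Pr_{(x,y)∼D}[y·f(x) ≤ γ]`. -/
noncomputable def margLossD {X : Type*} [MeasurableSpace X] (μ : Measure (X × ℝ)) (γ : ℝ)
    (f : X → ℝ) : ℝ :=
  (μ {p | p.2 * f p.1 ≤ γ}).toReal

/-- The empirical γ-margin loss `L_S^γ(f)`: the fraction of examples in `S` with margin at
most `γ`. -/
noncomputable def margLossS {X : Type*} {m : ℕ} (S : Fin m → X × ℝ) (γ : ℝ) (f : X → ℝ) : ℝ :=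
  (Nat.card {i : Fin m // (S i).2 * f (S i).1 ≤ γ} : ℝ) / m

/-- The empirical θ-margin loss of `f` on the subsequence of `Z` indexed by `s`. -/
noncomputable def lossIdx {X : Type*} {k : ℕ} (Z : Fin k → X × ℝ) (s : Finset (Fin k))
    (θ : ℝ) (f : X → ℝ) : ℝ :=
  (Nat.card {i : Fin k // i ∈ s ∧ (Z i).2 * f (Z i).1 ≤ θ} : ℝ) / s.card

/-- `L_{D_{c*}}(f) = Pr_{x∼D}[c*(x)·f(x) ≤ 0]`. -/
noncomputable def errD {X : Type*} [MeasurableSpace X] (D : Measure X) (c : X → ℝ)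
    (f : X → ℝ) : ℝ :=
  (D {x | c x * f x ≤ 0}).toReal

/-- `maj(f₁,f₂,f₃) = sign(sign f₁ + sign f₂ + sign f₃)`, with `sign 0 = 0`. -/
noncomputable def majf {X : Type*} (f₁ f₂ f₃ : X → ℝ) : X → ℝ :=
  fun x => Real.sign (Real.sign (f₁ x) + Real.sign (f₂ x) + Real.sign (f₃ x))


theorem aux_median {ι : Type*} [DecidableEq ι] (A : Finset ι) (φ : ι → ℝ) (hA : A.Nonempty) :
    ∃ M : ℝ, 2 * (A.filter (fun f => M < φ f)).card ≤ A.card ∧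
      2 * (A.filter (fun f => φ f < M)).card ≤ A.card := by
  classical
  set B := A.filter (fun f => 2 * (A.filter (fun h => φ f < φ h)).card ≤ A.card) with hB
  have hBn : B.Nonempty := by
    obtain ⟨f, hf, hmax⟩ := A.exists_max_image φ hA
    refine ⟨f, ?_⟩
    rw [hB, Finset.mem_filter]
    refine ⟨hf, ?_⟩
    rw [Finset.filter_false_of_mem]
    · simp
    · intro h hh
      exact not_lt.mpr (hmax h hh)
  obtain ⟨f0, hf0, hmin⟩ := B.exists_min_image φ hBn
  refine ⟨φ f0, (Finset.mem_filter.mp hf0).2, ?_⟩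
  by_cases hC : (A.filter (fun f => φ f < φ f0)).Nonempty
  · obtain ⟨f1, hf1, hmax⟩ := (A.filter (fun f => φ f < φ f0)).exists_max_image φ hC
    rw [Finset.mem_filter] at hf1
    have h1 : f1 ∉ B := fun h => absurd (hmin f1 h) (not_le.mpr hf1.2)
    have h2 : A.card < 2 * (A.filter (fun h => φ f1 < φ h)).card := by
      by_contra hcon
      exact h1 (Finset.mem_filter.mpr ⟨hf1.1, not_lt.mp hcon⟩)
    have h3 : (A.filter (fun h => φ f1 < φ h)) ⊆ A.filter (fun f => ¬ φ f < φ f0) := by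
      intro x hx
      rw [Finset.mem_filter] at hx ⊢
      refine ⟨hx.1, fun hlt => ?_⟩
      exact absurd (hmax x (Finset.mem_filter.mpr ⟨hx.1, hlt⟩)) (not_le.mpr hx.2)
    have h4 := Finset.card_le_card h3
    have h5 := Finset.card_filter_add_card_filter_not (s := A) (fun f => φ f < φ f0)
    omega
  · rw [Finset.not_nonempty_iff_eq_empty.mp hC]; simp

theorem aux_one_side {ι : Type*} (A : Finset ι) (φ : ι → ℝ) (hA : A.Nonempty)
    (g q M : ℝ) (hq : 1 ≤ q) (hg : 0 < g)
    (hM : 2 * (A.filter (fun f => M < φ f)).card ≤ A.card)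
    (H : ∀ u, 0 < (A.filter (fun f => u + g ≤ φ f)).card →
      0 < (A.filter (fun f => φ f ≤ u)).card →
      ((A.filter (fun f => u + g ≤ φ f)).card : ℝ) ^ (1 / q) +
        ((A.filter (fun f => φ f ≤ u)).card : ℝ) ^ (1 / q) < (A.card : ℝ) ^ (1 / q)) (j : ℕ) :
    ((A.filter (fun f => M + j * g < φ f)).card : ℝ) ≤ A.card * (1 / 2 : ℝ) ^ (q ^ j) := by
  have hN : (0 : ℝ) < A.card := by exact_mod_cast hA.card_pos
  have hq0 : 0 < q := by linarith
  induction j with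
  | zero =>
    have : (2 : ℝ) * (A.filter (fun f => M < φ f)).card ≤ A.card := by exact_mod_cast hM
    simp
    linarith
  | succ j ih =>
    set B := A.filter (fun f => M + j * g < φ f) with hB
    set B' := A.filter (fun f => M + (j + 1 : ℕ) * g < φ f) with hB'
    set u := M + j * g with hu
    have hug : M + ((j + 1 : ℕ) : ℝ) * g = u + g := by push_cast; ring
    set P := A.filter (fun f => u + g ≤ φ f) with hP
    set R := A.filter (fun f => φ f ≤ u) with hR
    have hhalf : (1 / 2 : ℝ) ^ (q ^ j) ≤ 1 / 2 := by
      have := Real.rpow_le_rpow_of_exponent_ge (x := 1 / 2) (by norm_num) (by norm_num)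
        (one_le_pow₀ hq : 1 ≤ q ^ j)
      simpa using this
    rcases Nat.eq_zero_or_pos B'.card with h0 | hpos
    · rw [h0, Nat.cast_zero]; positivity
    have hBP : B' ⊆ P := by
      intro x hx
      rw [hB', Finset.mem_filter, hug] at hx
      exact Finset.mem_filter.mpr ⟨hx.1, hx.2.le⟩
    have hBPc := Finset.card_le_card hBP
    have hRB : R.card + B.card = A.card := by
      have := Finset.card_filter_add_card_filter_not (s := A) (fun f => φ f ≤ u)
      simpa [hR, hB, not_le] using this
    have hRBr : (R.card : ℝ) = A.card - B.card := by
      rw [← hRB]; push_cast; ring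
    have hBhalf : (B.card : ℝ) ≤ A.card * (1 / 2) := ih.trans (by gcongr)
    have hRpos : (0 : ℝ) < R.card := by rw [hRBr]; linarith
    have key := H u (lt_of_lt_of_le hpos hBPc) (by exact_mod_cast hRpos)
    -- normalise
    set b : ℝ := B.card / A.card with hb
    set b' : ℝ := B'.card / A.card with hb'
    have hb0 : 0 ≤ b := by positivity
    have hb1 : b ≤ 1 / 2 := by rw [hb, div_le_iff₀ hN]; linarith
    have hb'0 : 0 ≤ b' := by positivity
    have hR' : (R.card : ℝ) = A.card * (1 - b) := by
      rw [hRBr, hb]; field_simp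
    have hPB : (A.card * b' : ℝ) ≤ P.card := by
      rw [hb', mul_div_cancel₀ _ hN.ne']; exact_mod_cast hBPc
    have hκ : 0 < 1 / q := by positivity
    have hκ1 : 1 / q ≤ 1 := by rw [div_le_one hq0]; exact hq
    have e1 : (A.card * b' : ℝ) ^ (1 / q) ≤ (P.card : ℝ) ^ (1 / q) :=
      Real.rpow_le_rpow (by positivity) hPB hκ.le
    rw [Real.mul_rpow hN.le hb'0] at e1
    rw [hR', Real.mul_rpow hN.le (by linarith)] at key
    have e2 : 1 - b ≤ (1 - b) ^ (1 / q) := by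
      have := Real.rpow_le_rpow_of_exponent_ge (x := 1 - b) (by linarith) (by linarith) hκ1
      simpa using this
    have hNk : 0 < (A.card : ℝ) ^ (1 / q) := Real.rpow_pos_of_pos hN _
    have e3 : b' ^ (1 / q) ≤ b := by
      have : (A.card : ℝ) ^ (1 / q) * (b' ^ (1 / q) + (1 - b)) ≤ (A.card : ℝ) ^ (1 / q) * 1 := by
        have := mul_le_mul_of_nonneg_left e2 hNk.le
        linarith
      have := le_of_mul_le_mul_left this hNk
      linarith
    have e4 : b' ≤ b ^ q := by
      have := Real.rpow_le_rpow (Real.rpow_nonneg hb'0 _) e3 hq0.le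
      rwa [← Real.rpow_mul hb'0, one_div_mul_cancel hq0.ne', Real.rpow_one] at this
    have e5 : b ≤ (1 / 2 : ℝ) ^ (q ^ j) := by
      rw [hb, div_le_iff₀ hN]; linarith
    have e6 : b' ≤ (1 / 2 : ℝ) ^ (q ^ (j + 1)) := by
      refine e4.trans ((Real.rpow_le_rpow hb0 e5 hq0.le).trans ?_)
      rw [← Real.rpow_mul (by norm_num), ← pow_succ]
    rw [hb', div_le_iff₀ hN] at e6
    linarith

theorem aux_split {m : ℕ} (A : Finset (Fin m → ℝ)) (hA : 2 ≤ A.card) (t q : ℝ) (d K : ℕ)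
    (ht : 0 < t) (hq : 1 ≤ q) (hK : 0 < K)
    (hsep : ∀ f ∈ A, ∀ h ∈ A, f ≠ h →
      d < (Finset.univ.filter (fun i => t < |f i - h i|)).card)
    (hqK : (8 * m : ℝ) * (1 / 2 : ℝ) ^ (q ^ K) ≤ d) :
    ∃ (i : Fin m) (u : ℝ), 0 < (A.filter (fun f => u + t / (2 * K) ≤ f i)).card ∧
      0 < (A.filter (fun f => f i ≤ u)).card ∧
      (A.card : ℝ) ^ (1 / q) ≤ ((A.filter (fun f => u + t / (2 * K) ≤ f i)).card : ℝ) ^ (1 / q) +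
        ((A.filter (fun f => f i ≤ u)).card : ℝ) ^ (1 / q) := by
  classical
  by_contra! hcon
  have hAne : A.Nonempty := Finset.card_pos.mp (by omega)
  have hKr : (0 : ℝ) < K := by exact_mod_cast hK
  have hg : 0 < t / (2 * K) := by positivity
  set g := t / (2 * K) with hgdef
  have hKg : K * g = t / 2 := by rw [hgdef]; field_simp
  set η : ℝ := (1 / 2 : ℝ) ^ (q ^ K) with hη
  have hbad : ∀ i : Fin m, ∃ M : ℝ,
      ((A.filter (fun f => t / 2 < |f i - M|)).card : ℝ) ≤ 2 * A.card * η := by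
    intro i
    obtain ⟨M, h1, h2⟩ := aux_median A (fun f => f i) hAne
    refine ⟨M, ?_⟩
    have u1 := aux_one_side A (fun f => f i) hAne g q M hq hg h1 (fun u a b => hcon i u a b) K
    have u2 := aux_one_side A (fun f => - f i) hAne g q (-M) hq hg
      (by simpa using h2) (fun u a b => by
        have ea : (A.filter (fun f => u + g ≤ - f i)) = A.filter (fun f => f i ≤ -u - g) :=
          Finset.filter_congr (fun x _ => by constructor <;> intro h <;> linarith)
        have eb : (A.filter (fun f => - f i ≤ u)) = A.filter (fun f => (-u - g) + g ≤ f i) :=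
          Finset.filter_congr (fun x _ => by constructor <;> intro h <;> linarith)
        rw [ea] at a ⊢
        rw [eb] at b ⊢
        rw [add_comm]
        exact hcon i (-u - g) b a) K
    have hsub : A.filter (fun f => t / 2 < |f i - M|) ⊆
        A.filter (fun f => M + K * g < f i) ∪ A.filter (fun f => -M + K * g < - f i) := by
      intro f hf
      rw [Finset.mem_filter] at hf
      rw [Finset.mem_union, Finset.mem_filter, Finset.mem_filter, hKg]
      rcases lt_abs.mp hf.2 with h | h
      · left; exact ⟨hf.1, by linarith⟩
      · right; exact ⟨hf.1, by linarith⟩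
    have := (Finset.card_le_card hsub).trans (Finset.card_union_le _ _)
    have this : ((A.filter (fun f => t / 2 < |f i - M|)).card : ℝ) ≤
      (A.filter (fun f => M + K * g < f i)).card +
        (A.filter (fun f => -M + K * g < - f i)).card := by exact_mod_cast this
    linarith
  choose M hM using hbad
  have hN : (2 : ℝ) ≤ A.card := by exact_mod_cast hA
  set N : ℝ := (A.card : ℝ) with hNdef
  -- triple count
  have up : ∀ i : Fin m,
      (((A ×ˢ A).filter (fun p => t < |p.1 i - p.2 i|)).card : ℝ) ≤ 4 * N ^ 2 * η := by
    intro i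
    set Bd := A.filter (fun f => t / 2 < |f i - M i|) with hBd
    have hsub : (A ×ˢ A).filter (fun p => t < |p.1 i - p.2 i|) ⊆ (Bd ×ˢ A) ∪ (A ×ˢ Bd) := by
      intro p hp
      rw [Finset.mem_filter, Finset.mem_product] at hp
      rw [Finset.mem_union, Finset.mem_product, Finset.mem_product, hBd, Finset.mem_filter,
        Finset.mem_filter]
      by_contra hc
      have h1 : |p.1 i - M i| ≤ t / 2 := by
        by_contra h; exact hc (Or.inl ⟨⟨hp.1.1, not_le.mp h⟩, hp.1.2⟩)
      have h2 : |p.2 i - M i| ≤ t / 2 := by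
        by_contra h; exact hc (Or.inr ⟨hp.1.1, ⟨hp.1.2, not_le.mp h⟩⟩)
      have h3 := hp.2
      rw [abs_le] at h1 h2
      rcases lt_abs.mp h3 with h | h <;> linarith
    have := (Finset.card_le_card hsub).trans (Finset.card_union_le _ _)
    rw [Finset.card_product, Finset.card_product] at this
    have this : (((A ×ˢ A).filter (fun p => t < |p.1 i - p.2 i|)).card : ℝ) ≤
      Bd.card * A.card + A.card * Bd.card := by exact_mod_cast this
    have hMi := hM i
    have := mul_le_mul_of_nonneg_right hMi (by linarith : 0 ≤ N)
    nlinarith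
  have low : (N * (N - 1) * (d + 1) : ℝ) ≤
      ∑ p ∈ A ×ˢ A, ((Finset.univ.filter (fun i => t < |p.1 i - p.2 i|)).card : ℝ) := by
    calc (N * (N - 1) * (d + 1) : ℝ) = ∑ p ∈ A.offDiag, ((d : ℝ) + 1) := by
          rw [Finset.sum_const, Finset.offDiag_card, nsmul_eq_mul, Nat.cast_sub (Nat.le_mul_self _)]
          push_cast; rw [← hNdef]; ring
      _ ≤ ∑ p ∈ A.offDiag, ((Finset.univ.filter (fun i => t < |p.1 i - p.2 i|)).card : ℝ) := by
          refine Finset.sum_le_sum (fun p hp => ?_)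
          rw [Finset.mem_offDiag] at hp
          exact_mod_cast hsep p.1 hp.1 p.2 hp.2.1 hp.2.2
      _ ≤ _ := by
          refine Finset.sum_le_sum_of_subset_of_nonneg ?_ (fun _ _ _ => by positivity)
          intro p hp
          rw [Finset.mem_offDiag] at hp
          exact Finset.mem_product.mpr ⟨hp.1, hp.2.1⟩
  have swap : ∑ p ∈ A ×ˢ A, ((Finset.univ.filter (fun i => t < |p.1 i - p.2 i|)).card : ℝ) =
      ∑ i : Fin m, (((A ×ˢ A).filter (fun p => t < |p.1 i - p.2 i|)).card : ℝ) := by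
    simp only [Finset.card_filter, Nat.cast_sum]
    exact Finset.sum_comm
  have tot : ∑ i : Fin m, (((A ×ˢ A).filter (fun p => t < |p.1 i - p.2 i|)).card : ℝ) ≤
      m * (4 * N ^ 2 * η) := by
    refine (Finset.sum_le_sum (fun i _ => up i)).trans ?_
    simp
  rw [swap] at low
  have h1 := low.trans tot
  have h2 := mul_le_mul_of_nonneg_left hqK (by positivity : (0 : ℝ) ≤ N ^ 2)
  have hd : (0 : ℝ) ≤ d := by positivity
  nlinarith [mul_nonneg (mul_nonneg (by linarith : 0 ≤ N) (by linarith : 0 ≤ N - 2)) (by linarith : (0:ℝ) ≤ d + 1)]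

/-- `A` shatters the set `W` of (coordinate, level) pairs. -/
def AuxShat {m : ℕ} (s β : ℝ) (A : Finset (Fin m → ℝ)) (W : Finset (Fin m × ℤ)) : Prop :=
  ∀ b : Fin m × ℤ → Bool, ∃ f ∈ A, ∀ p ∈ W,
    (b p = true → s * p.2 + β ≤ f p.1) ∧ (b p = false → f p.1 ≤ s * p.2 - β)

open Classical in
theorem aux_sh_split {m : ℕ} (s β : ℝ) (hβ : 0 < β) (P : Finset (Fin m × ℤ))
    (A A1 A2 : Finset (Fin m → ℝ)) (p : Fin m × ℤ) (hp : p ∈ P)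
    (h1 : A1 ⊆ A) (h2 : A2 ⊆ A) (h1' : ∀ f ∈ A1, s * p.2 + β ≤ f p.1)
    (h2' : ∀ f ∈ A2, f p.1 ≤ s * p.2 - β) :
    (P.powerset.filter (AuxShat s β A1)).card + (P.powerset.filter (AuxShat s β A2)).card ≤
      (P.powerset.filter (AuxShat s β A)).card := by
  set S1 := P.powerset.filter (AuxShat s β A1) with hS1
  set S2 := P.powerset.filter (AuxShat s β A2) with hS2
  have n1 : ∀ W ∈ S1, p ∉ W := by
    intro W hW hpW
    obtain ⟨f, hf, hfW⟩ := (Finset.mem_filter.mp hW).2 (fun _ => false)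
    have a := (hfW p hpW).2 rfl
    have b := h1' f hf
    linarith
  have hdisj : Disjoint (S1 ∪ S2) ((S1 ∩ S2).image (insert p)) := by
    rw [Finset.disjoint_left]
    intro W hW hW'
    obtain ⟨W0, _, rfl⟩ := Finset.mem_image.mp hW'
    rcases Finset.mem_union.mp hW with h | h
    · exact n1 _ h (Finset.mem_insert_self _ _)
    · obtain ⟨f, hf, hfW⟩ := (Finset.mem_filter.mp h).2 (fun _ => true)
      have a := (hfW p (Finset.mem_insert_self _ _)).1 rfl
      have b := h2' f hf
      linarith
  have hinj : ((S1 ∩ S2).image (insert p)).card = (S1 ∩ S2).card := by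
    apply Finset.card_image_of_injOn
    intro W hW W' hW' heq
    have a := n1 W (Finset.mem_inter.mp hW).1
    have b := n1 W' (Finset.mem_inter.mp hW').1
    have : (insert p W).erase p = (insert p W').erase p := by
      exact congrArg (fun V => Finset.erase V p) heq
    rwa [Finset.erase_insert a, Finset.erase_insert b] at this
  have hsub : (S1 ∪ S2) ∪ ((S1 ∩ S2).image (insert p)) ⊆ P.powerset.filter (AuxShat s β A) := by
    intro W hW
    rcases Finset.mem_union.mp hW with h | h
    · rcases Finset.mem_union.mp h with h | h
      · rw [hS1, Finset.mem_filter] at h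
        refine Finset.mem_filter.mpr ⟨h.1, fun b => ?_⟩
        obtain ⟨f, hf, hfW⟩ := h.2 b
        exact ⟨f, h1 hf, hfW⟩
      · rw [hS2, Finset.mem_filter] at h
        refine Finset.mem_filter.mpr ⟨h.1, fun b => ?_⟩
        obtain ⟨f, hf, hfW⟩ := h.2 b
        exact ⟨f, h2 hf, hfW⟩
    · obtain ⟨W0, hW0, rfl⟩ := Finset.mem_image.mp h
      have ha := (Finset.mem_filter.mp (Finset.mem_inter.mp hW0).1)
      have hb := (Finset.mem_filter.mp (Finset.mem_inter.mp hW0).2)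
      refine Finset.mem_filter.mpr ⟨?_, fun b => ?_⟩
      · rw [Finset.mem_powerset] at ha ⊢
        exact Finset.insert_subset hp ha.1
      · cases hbp : b p
        · obtain ⟨f, hf, hfW⟩ := hb.2 b
          refine ⟨f, h2 hf, fun r hr => ?_⟩
          rcases Finset.mem_insert.mp hr with rfl | hr
          · exact ⟨fun h => by simp [hbp] at h, fun _ => h2' f hf⟩
          · exact hfW r hr
        · obtain ⟨f, hf, hfW⟩ := ha.2 b
          refine ⟨f, h1 hf, fun r hr => ?_⟩
          rcases Finset.mem_insert.mp hr with rfl | hr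
          · exact ⟨fun _ => h1' f hf, fun h => by simp [hbp] at h⟩
          · exact hfW r hr
  have := Finset.card_le_card hsub
  rw [Finset.card_union_of_disjoint hdisj, hinj, Finset.card_union_add_card_inter] at this
  exact this

theorem aux_binom {ι : Type*} [DecidableEq ι] (P : Finset ι) (d : ℕ) (hd : 0 < d) (hdn : d ≤ P.card) :
    ((P.powerset.filter (fun W => W.card ≤ d)).card : ℝ) ≤
      (Real.exp 1 * P.card / d) ^ d := by
  set n := P.card with hn
  have hd' : (0 : ℝ) < d := by exact_mod_cast hd
  have hn' : (0 : ℝ) < n := by exact_mod_cast (lt_of_lt_of_le hd hdn)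
  set x : ℝ := d / n with hx
  have hx0 : 0 < x := by positivity
  have hx1 : x ≤ 1 := by rw [hx, div_le_one hn']; exact_mod_cast hdn
  have h1 : ((P.powerset.filter (fun W => W.card ≤ d)).card : ℝ) * x ^ d ≤ Real.exp d := by
    calc ((P.powerset.filter (fun W => W.card ≤ d)).card : ℝ) * x ^ d
        = ∑ W ∈ P.powerset.filter (fun W => W.card ≤ d), x ^ d := by simp
      _ ≤ ∑ W ∈ P.powerset.filter (fun W => W.card ≤ d), x ^ W.card := by
          refine Finset.sum_le_sum (fun W hW => ?_)
          exact pow_le_pow_of_le_one hx0.le hx1 (Finset.mem_filter.mp hW).2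
      _ ≤ ∑ W ∈ P.powerset, x ^ W.card :=
          Finset.sum_le_sum_of_subset_of_nonneg (Finset.filter_subset _ _)
            (fun _ _ _ => by positivity)
      _ = (x + 1) ^ n := by
          have := Finset.sum_pow_mul_eq_add_pow x 1 P
          simpa using this
      _ ≤ (Real.exp x) ^ n := by gcongr; exact Real.add_one_le_exp x
      _ = Real.exp d := by rw [← Real.exp_nat_mul, hx]; congr 1; field_simp
  have h2 : Real.exp d = (Real.exp 1 * n / d) ^ d * x ^ d := by
    rw [← mul_pow, hx]
    have : Real.exp 1 * n / d * (d / n) = Real.exp 1 := by field_simp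
    rw [this, ← Real.exp_nat_mul, mul_one]
  rw [h2] at h1
  exact le_of_mul_le_mul_right h1 (by positivity)

open Classical in
theorem aux_count {m : ℕ} (t q γ : ℝ) (d K : ℕ) (Z : ℕ)
    (ht : 0 < t) (hq : 1 ≤ q) (hK : 0 < K) (g : ℝ) (hg : g = t / (2 * K))
    (hZ : γ ≤ g / 2 * Z)
    (hqK : (8 * m : ℝ) * (1 / 2 : ℝ) ^ (q ^ K) ≤ d) (k : ℕ) :
    ∀ A : Finset (Fin m → ℝ), A.card = k → A.Nonempty →
    (∀ f ∈ A, ∀ i, |f i| ≤ γ) →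
    (∀ f ∈ A, ∀ h ∈ A, f ≠ h →
      d < (Finset.univ.filter (fun i => t < |f i - h i|)).card) →
    (A.card : ℝ) ^ (1 / q) ≤
      (((Finset.univ ×ˢ Finset.Icc (-(Z : ℤ)) Z : Finset (Fin m × ℤ)).powerset.filter
        (AuxShat (g / 2) (g / 4) A)).card : ℝ) := by
  have hKr : (0 : ℝ) < K := by exact_mod_cast hK
  have hg0 : 0 < g := by rw [hg]; positivity
  induction k using Nat.strong_induction_on with
  | _ k ih =>
  intro A hk hA hbd hsep
  set P : Finset (Fin m × ℤ) := Finset.univ ×ˢ Finset.Icc (-(Z : ℤ)) Z with hP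
  by_cases h2 : 2 ≤ A.card
  · obtain ⟨i, u, hp, hr, hle⟩ := aux_split A h2 t q d K ht hq hK hsep hqK
    rw [← hg] at hp hle
    set z : ℤ := ⌈(u + g / 4) / (g / 2)⌉ with hz
    have hz1 : u + g / 4 ≤ g / 2 * z := by
      have := Int.le_ceil ((u + g / 4) / (g / 2))
      rw [← hz, div_le_iff₀ (by positivity)] at this
      linarith
    have hz2 : g / 2 * z ≤ u + 3 * g / 4 := by
      have := Int.ceil_lt_add_one ((u + g / 4) / (g / 2))
      rw [← hz, ← sub_lt_iff_lt_add, lt_div_iff₀ (by positivity)] at this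
      linarith
    set A1 := A.filter (fun f => u + g ≤ f i) with hA1
    set A2 := A.filter (fun f => f i ≤ u) with hA2
    obtain ⟨f1, hf1⟩ := Finset.card_pos.mp hp
    obtain ⟨f2, hf2⟩ := Finset.card_pos.mp hr
    have hf1' := Finset.mem_filter.mp hf1
    have hf2' := Finset.mem_filter.mp hf2
    have b1 := abs_le.mp (hbd f1 hf1'.1 i)
    have b2 := abs_le.mp (hbd f2 hf2'.1 i)
    have hmem : (i, z) ∈ P := by
      rw [hP, Finset.mem_product]
      refine ⟨Finset.mem_univ _, Finset.mem_Icc.mpr ⟨?_, ?_⟩⟩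
      · have : g / 2 * (-(Z : ℝ)) ≤ g / 2 * z := by linarith
        have := le_of_mul_le_mul_left this (by positivity)
        exact_mod_cast this
      · have : g / 2 * (z : ℝ) ≤ g / 2 * Z := by linarith
        have := le_of_mul_le_mul_left this (by positivity)
        exact_mod_cast this
    have s1 : A1 ⊆ A := Finset.filter_subset _ _
    have s2 : A2 ⊆ A := Finset.filter_subset _ _
    have l1 : A1.card < k := by
      rw [← hk]
      refine Finset.card_lt_card ((Finset.ssubset_iff_of_subset s1).mpr ⟨f2, hf2'.1, fun h => ?_⟩)
      have := (Finset.mem_filter.mp h).2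
      linarith [hf2'.2]
    have l2 : A2.card < k := by
      rw [← hk]
      refine Finset.card_lt_card ((Finset.ssubset_iff_of_subset s2).mpr ⟨f1, hf1'.1, fun h => ?_⟩)
      have := (Finset.mem_filter.mp h).2
      linarith [hf1'.2]
    have i1 := ih _ l1 A1 rfl ⟨f1, hf1⟩ (fun f hf => hbd f (s1 hf))
      (fun f hf h hh => hsep f (s1 hf) h (s1 hh))
    have i2 := ih _ l2 A2 rfl ⟨f2, hf2⟩ (fun f hf => hbd f (s2 hf))
      (fun f hf h hh => hsep f (s2 hf) h (s2 hh))
    have sp := aux_sh_split (g / 2) (g / 4) (by positivity) P A A1 A2 (i, z) hmem s1 s2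
      (fun f hf => by
        have := (Finset.mem_filter.mp hf).2
        simp only
        linarith)
      (fun f hf => by
        have := (Finset.mem_filter.mp hf).2
        simp only
        linarith)
    have sp' : ((P.powerset.filter (AuxShat (g / 2) (g / 4) A1)).card : ℝ) +
        (P.powerset.filter (AuxShat (g / 2) (g / 4) A2)).card ≤
        (P.powerset.filter (AuxShat (g / 2) (g / 4) A)).card := by exact_mod_cast sp
    linarith
  · have h1 : A.card = 1 := by
      have := hA.card_pos
      omega
    rw [h1]
    simp only [Nat.cast_one, Real.one_rpow]
    have : 0 < (P.powerset.filter (AuxShat (g / 2) (g / 4) A)).card := by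
      refine Finset.card_pos.mpr ⟨∅, Finset.mem_filter.mpr ⟨by simp, fun b => ?_⟩⟩
      obtain ⟨f, hf⟩ := hA
      exact ⟨f, hf, by simp⟩
    exact_mod_cast this

open Classical in
theorem aux_cover {m : ℕ} (G : Set (Fin m → ℝ)) (t q γ : ℝ) (d K : ℕ) (Z : ℕ)
    (ht : 0 < t) (hq : 1 ≤ q) (hK : 0 < K) (g : ℝ) (hg : g = t / (2 * K))
    (hZ : γ ≤ g / 2 * Z) (hd : 0 < d) (hdm : d ≤ m)
    (hqK : (8 * m : ℝ) * (1 / 2 : ℝ) ^ (q ^ K) ≤ d)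
    (hbd : ∀ f ∈ G, ∀ i, |f i| ≤ γ)
    (hsh : ∀ (A : Finset (Fin m → ℝ)) W, (∀ f ∈ A, f ∈ G) →
      AuxShat (g / 2) (g / 4) A W → W.card ≤ d) (B : ℝ)
    (hB : B = (Real.exp 1 * (m * (2 * Z + 1)) / d) ^ d) :
    ∃ N : Finset (Fin m → ℝ), (∀ f ∈ G, ∃ h ∈ N, ∀ i, |f i - h i| ≤ t) ∧
      (N.card : ℝ) ≤ B ^ q * B := by
  have hKr : (1 : ℝ) ≤ K := by exact_mod_cast hK
  have hg0 : 0 < g := by rw [hg]; positivity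
  have hq0 : 0 < q := by linarith
  set P : Finset (Fin m × ℤ) := Finset.univ ×ˢ Finset.Icc (-(Z : ℤ)) Z with hP
  set U := P.powerset.filter (fun W => W.card ≤ d) with hU
  have hPc : P.card = m * (2 * Z + 1) := by
    rw [hP, Finset.card_product, Int.card_Icc, Finset.card_univ, Fintype.card_fin]
    congr 1
    omega
  have hUB : (U.card : ℝ) ≤ B := by
    have := aux_binom P d hd (by rw [hPc]; nlinarith)
    rw [hPc] at this
    rw [hB]
    exact_mod_cast this
  have hB0 : 0 ≤ B := le_trans (Nat.cast_nonneg _) hUB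
  let Good : Finset (Fin m → ℝ) → Prop := fun A => (∀ f ∈ A, f ∈ G) ∧
    ∀ f ∈ A, ∀ h ∈ A, f ≠ h → d < (Finset.univ.filter (fun i => t < |f i - h i|)).card
  have hGood : ∀ A, Good A → (A.card : ℝ) ≤ B ^ q := by
    intro A hA
    rcases A.eq_empty_or_nonempty with rfl | hne
    · simp; positivity
    have h1 := aux_count t q γ d K Z ht hq hK g hg hZ hqK A.card A rfl hne
      (fun f hf => hbd f (hA.1 f hf)) hA.2
    have h2 : (P.powerset.filter (AuxShat (g / 2) (g / 4) A)) ⊆ U := by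
      intro W hW
      rw [Finset.mem_filter] at hW
      exact Finset.mem_filter.mpr ⟨hW.1, hsh A W hA.1 hW.2⟩
    have h3 : ((P.powerset.filter (AuxShat (g / 2) (g / 4) A)).card : ℝ) ≤ U.card := by
      exact_mod_cast Finset.card_le_card h2
    have h4 := (h1.trans h3).trans hUB
    have h5 := Real.rpow_le_rpow (by positivity) h4 hq0.le
    rwa [← Real.rpow_mul (by positivity), one_div_mul_cancel hq0.ne', Real.rpow_one] at h5
  obtain ⟨A, hA, hmax⟩ : ∃ A, Good A ∧ ∀ A', Good A' → A'.card ≤ A.card := by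
    let S : Set ℕ := {n | ∃ A, Good A ∧ A.card = n}
    have hS : S.Nonempty := ⟨0, ∅, ⟨by simp, by simp⟩, by simp⟩
    have hSb : BddAbove S := by
      refine ⟨⌊B ^ q⌋₊, ?_⟩
      rintro n ⟨A, hA, rfl⟩
      exact Nat.le_floor (hGood A hA)
    obtain ⟨A, hA, hc⟩ := Nat.sSup_mem hS hSb
    exact ⟨A, hA, fun A' hA' => hc ▸ le_csSup hSb ⟨A', hA', rfl⟩⟩
  have hnear : ∀ f ∈ G, ∃ a ∈ A, (Finset.univ.filter (fun i => t < |f i - a i|)).card ≤ d := by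
    intro f hf
    by_contra! hc
    have hfA : f ∉ A := by
      intro h
      have := hc f h
      simp [not_lt.mpr ht.le] at this
    have hins : Good (insert f A) := by
      refine ⟨fun h hh => ?_, fun h hh h' hh' hne => ?_⟩
      · rcases Finset.mem_insert.mp hh with rfl | hh
        · exact hf
        · exact hA.1 h hh
      · rcases Finset.mem_insert.mp hh with rfl | hh2
        · rcases Finset.mem_insert.mp hh' with rfl | hh3
          · exact absurd rfl hne
          · exact hc h' hh3
        · rcases Finset.mem_insert.mp hh' with rfl | hh3
          · have := hc h hh2
            simpa only [abs_sub_comm] using this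
          · exact hA.2 h hh2 h' hh3 hne
    have := hmax _ hins
    rw [Finset.card_insert_of_notMem hfA] at this
    omega
  let Φ : (Fin m → ℝ) × Finset (Fin m × ℤ) → (Fin m → ℝ) := fun p i =>
    if h : ∃ z, (i, z) ∈ p.2 then g / 2 * (h.choose : ℝ) else p.1 i
  refine ⟨(A ×ˢ U).image Φ, ?_, ?_⟩
  · intro f hf
    obtain ⟨a, ha, hac⟩ := hnear f hf
    set D := Finset.univ.filter (fun i => t < |f i - a i|) with hD
    set W := D.image (fun i => ((i, ⌊f i / (g / 2)⌋) : Fin m × ℤ)) with hW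
    have hWU : W ∈ U := by
      refine Finset.mem_filter.mpr ⟨Finset.mem_powerset.mpr ?_, Finset.card_image_le.trans hac⟩
      intro p hp
      obtain ⟨i, _, rfl⟩ := Finset.mem_image.mp hp
      have hb := abs_le.mp (hbd f hf i)
      refine Finset.mem_product.mpr ⟨Finset.mem_univ _, Finset.mem_Icc.mpr ⟨?_, ?_⟩⟩
      · refine Int.le_floor.mpr ?_
        rw [le_div_iff₀ (by positivity)]
        push_cast
        linarith
      · have h1 := Int.floor_le (f i / (g / 2))
        have h2 : f i / (g / 2) ≤ Z := by
          rw [div_le_iff₀ (by positivity)]; linarith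
        have := h1.trans h2
        exact_mod_cast this
    refine ⟨Φ (a, W), Finset.mem_image_of_mem _ (Finset.mem_product.mpr ⟨ha, hWU⟩), fun i => ?_⟩
    by_cases h : ∃ z, (i, z) ∈ W
    · have e : Φ (a, W) i = g / 2 * (h.choose : ℝ) := by
        simp only [Φ]; rw [dif_pos h]
      obtain ⟨j, _, hj⟩ := Finset.mem_image.mp h.choose_spec
      rw [Prod.mk.injEq] at hj
      obtain ⟨rfl, hj2⟩ := hj
      rw [e, ← hj2]
      have h1 := Int.floor_le (f j / (g / 2))
      have h2 := Int.lt_floor_add_one (f j / (g / 2))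
      rw [le_div_iff₀ (by positivity)] at h1
      rw [div_lt_iff₀ (by positivity)] at h2
      have h3 : g / 2 ≤ t := by
        have : g ≤ t := by
          rw [hg, div_le_iff₀ (by positivity)]; nlinarith
        linarith
      rw [abs_le]
      constructor <;> linarith
    · have e : Φ (a, W) i = a i := by
        simp only [Φ]; rw [dif_neg h]
      rw [e]
      by_contra hc
      exact h ⟨_, Finset.mem_image_of_mem _ (Finset.mem_filter.mpr ⟨Finset.mem_univ i, not_le.mp hc⟩)⟩
  · have h1 : (((A ×ˢ U).image Φ).card : ℝ) ≤ A.card * U.card := by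
      have := Finset.card_image_le (s := A ×ˢ U) (f := Φ)
      rw [Finset.card_product] at this
      exact_mod_cast this
    exact h1.trans (mul_le_mul (hGood A hA) hUB (by positivity) (by positivity))

set_option maxHeartbeats 2000000 in
theorem aux_num (m d K Z : ℕ) (α ε L : ℝ) (hd : 0 < d) (hdm : d ≤ m) (hα : 0 < α)
    (hα2 : α < 1 / 2) (hε : 0 < ε) (hL : L = Real.log (2 * m / (d * α)))
    (hK : K = ⌈min (1 / ε) L⌉₊) (hZ : Z = ⌈4 * K / α⌉₊) :
    0 < K ∧ (1 : ℝ) ≤ 3 * L ^ (1 / (K : ℝ)) ∧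
    (8 * m : ℝ) * (1 / 2 : ℝ) ^ ((3 * L ^ (1 / (K : ℝ))) ^ K) ≤ d ∧
    ((Real.exp 1 * (m * (2 * Z + 1)) / d) ^ d) ^ (3 * L ^ (1 / (K : ℝ))) *
      (Real.exp 1 * (m * (2 * Z + 1)) / d) ^ d ≤ Real.exp (50 * d * L ^ (1 + ε)) := by
  have hd' : (1 : ℝ) ≤ d := by exact_mod_cast hd
  have hdm' : (d : ℝ) ≤ m := by exact_mod_cast hdm
  have hm' : (1 : ℝ) ≤ m := by linarith
  set y : ℝ := 2 * m / (d * α) with hy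
  have hdα : 0 < d * α := by positivity
  have hy4 : 4 ≤ y := by
    rw [hy, le_div_iff₀ hdα]; nlinarith
  have hy0 : 0 < y := by linarith
  have hmd : (m : ℝ) = y * (d * α) / 2 := by rw [hy]; field_simp
  have hyL : Real.exp L = y := by rw [hL, Real.exp_log hy0]
  have hL1 : 1.38 ≤ L := by
    have h1 : Real.log 4 ≤ L := by rw [hL]; exact Real.log_le_log (by norm_num) hy4
    have h2 : Real.log 4 = 2 * Real.log 2 := by
      rw [show (4 : ℝ) = 2 ^ 2 by norm_num, Real.log_pow]; norm_num
    have := Real.log_two_gt_d9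
    linarith
  have hL0 : 0 < L := by linarith
  have hLy : L + 1 ≤ y := by
    have := Real.add_one_le_exp L; linarith
  have hmin : 0 < min (1 / ε) L := lt_min (by positivity) hL0
  have hK0 : 0 < K := by rw [hK]; exact Nat.ceil_pos.mpr hmin
  have hK1 : (1 : ℝ) ≤ K := by exact_mod_cast hK0
  have hKlow : min (1 / ε) L ≤ K := by rw [hK]; exact Nat.le_ceil _
  have hKup : (K : ℝ) ≤ y := by
    have h1 := Nat.ceil_lt_add_one hmin.le
    rw [← hK] at h1
    have := min_le_right (1 / ε) L
    linarith
  set l : ℝ := L ^ (1 / (K : ℝ)) with hl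
  have hl1 : 1 ≤ l := Real.one_le_rpow (by linarith) (by positivity)
  have hlK : l ^ K = L := by
    rw [hl, ← Real.rpow_natCast, ← Real.rpow_mul hL0.le, one_div_mul_cancel (by positivity),
      Real.rpow_one]
  have hLε : 1 ≤ L ^ ε := Real.one_le_rpow (by linarith) hε.le
  have he : Real.exp 1 < 2.7182818286 := Real.exp_one_lt_d9
  have hlε : l ≤ Real.exp 1 * L ^ ε := by
    have he1 : 1 ≤ Real.exp 1 := Real.one_le_exp (by norm_num)
    rcases le_total (1 / ε) L with h | h
    · rw [min_eq_left h] at hKlow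
      have h1 : 1 / (K : ℝ) ≤ ε := by
        rw [div_le_iff₀ (by positivity)]
        rw [div_le_iff₀ hε] at hKlow
        linarith
      have h2 : l ≤ L ^ ε := Real.rpow_le_rpow_of_exponent_le (by linarith) h1
      nlinarith
    · rw [min_eq_right h] at hKlow
      have h1 : 1 / (K : ℝ) ≤ 1 / L := one_div_le_one_div_of_le hL0 hKlow
      have h2 : l ≤ L ^ (1 / L) := Real.rpow_le_rpow_of_exponent_le (by linarith) h1
      have h3 : L ^ (1 / L) ≤ Real.exp 1 := by
        rw [Real.rpow_def_of_pos hL0]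
        apply Real.exp_le_exp.mpr
        rw [mul_one_div, div_le_one hL0]
        have := Real.log_le_sub_one_of_pos hL0
        linarith
      nlinarith
  refine ⟨hK0, by linarith, ?_, ?_⟩
  · have h1 : 3 * L ≤ (3 * l) ^ K := by
      rw [mul_pow, hlK]
      have : (3 : ℝ) ^ 1 ≤ 3 ^ K := pow_le_pow_right₀ (by norm_num) hK0
      nlinarith
    have h2 : (1 / 2 : ℝ) ^ ((3 * l) ^ K) ≤ (1 / 2 : ℝ) ^ (3 * L) :=
      Real.rpow_le_rpow_of_exponent_ge (by norm_num) (by norm_num) h1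
    have h3 : (1 / 2 : ℝ) ^ (3 * L) ≤ (y ^ 2)⁻¹ := by
      rw [Real.rpow_def_of_pos (by norm_num), ← hyL, ← Real.exp_nat_mul, ← Real.exp_neg]
      apply Real.exp_le_exp.mpr
      rw [one_div, Real.log_inv]
      have := Real.log_two_gt_d9
      push_cast
      nlinarith
    have h4 := h2.trans h3
    have h5 : (8 * m : ℝ) * (y ^ 2)⁻¹ ≤ d := by
      rw [← div_eq_mul_inv, div_le_iff₀ (by positivity)]
      have : (m : ℝ) ≤ y * d / 4 := by
        rw [hmd]; nlinarith [mul_pos hy0 (by linarith : (0:ℝ) < d)]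
      nlinarith [mul_pos hy0 (by linarith : (0:ℝ) < d)]
    exact (mul_le_mul_of_nonneg_left h4 (by positivity)).trans h5
  · have hZup : (Z : ℝ) ≤ 4 * K / α + 1 := by
      rw [hZ]; exact (Nat.ceil_lt_add_one (by positivity)).le
    have hKα : 2 ≤ K / α := by
      rw [le_div_iff₀ hα]; linarith
    have hM : (2 * Z + 1 : ℝ) ≤ 10 * (K / α) := by
      have : 4 * (K : ℝ) / α = 4 * (K / α) := by ring
      linarith
    have hbase : Real.exp 1 * (m * (2 * Z + 1)) / d ≤ y ^ 5 := by
      calc Real.exp 1 * (m * (2 * Z + 1)) / d ≤ Real.exp 1 * (m * (10 * (K / α))) / d := by gcongr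
        _ = 5 * Real.exp 1 * K * y := by rw [hy]; field_simp; ring
        _ ≤ 5 * Real.exp 1 * y * y := by gcongr
        _ ≤ y ^ 3 * y * y := by
            gcongr
            have : (4 : ℝ) ^ 3 ≤ y ^ 3 := by gcongr
            linarith
        _ = y ^ 5 := by ring
    set B : ℝ := (Real.exp 1 * (m * (2 * Z + 1)) / d) ^ d with hBdef
    have hB0 : 0 ≤ B := by positivity
    have hB : B ≤ Real.exp (5 * L * d) := by
      calc B ≤ (y ^ 5) ^ d := by rw [hBdef]; gcongr
        _ = Real.exp (5 * L * d) := by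
          rw [← hyL, ← Real.exp_nat_mul, ← Real.exp_nat_mul]; congr 1; push_cast; ring
    calc B ^ (3 * l) * B ≤ (Real.exp (5 * L * d)) ^ (3 * l) * Real.exp (5 * L * d) := by gcongr
      _ = Real.exp (5 * L * d * (3 * l + 1)) := by
          rw [← Real.exp_mul, ← Real.exp_add]; congr 1; ring
      _ ≤ Real.exp (50 * d * L ^ (1 + ε)) := by
          apply Real.exp_le_exp.mpr
          rw [Real.rpow_add hL0, Real.rpow_one]
          have : 3 * l + 1 ≤ 10 * L ^ ε := by nlinarith
          calc 5 * L * d * (3 * l + 1) ≤ 5 * L * d * (10 * L ^ ε) := by gcongr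
            _ = _ := by ring

/-- Lemma `covering` (covering number via fat-shattering dimension). -/
theorem stmt_4 :
    ∃ C c : ℝ, 1 ≤ C ∧ 0 < c ∧
      ∀ (X : Type) (m : ℕ) (xs : Fin m → X) (H : Set (X → ℝ)),
        (∀ h ∈ H, ∀ x, h x = 1 ∨ h x = -1) →
        ∀ (ε α γ : ℝ), 0 < ε → ε < 1 → 0 < α → α < 1 / 2 → 0 < γ → γ ≤ 1 →
        ∀ d : ℕ,
          fatDim (clipClass (votingClassifiers H) γ) (c * α * ε * γ) = (d : ℕ∞) →
          d ≤ m →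
          coveringNumber xs (clipClass (votingClassifiers H) γ) (α * γ) ≤
            ENNReal.ofReal (Real.exp (C * d *
              (Real.log (2 * m / (d * α))) ^ ((1 : ℝ) + ε))) := by
  refine ⟨50, 1 / 32, by norm_num, by norm_num, ?_⟩
  intro X m xs H hH ε α γ hε hε1 hα hα2 hγ hγ1 d hfat hdm
  set F := clipClass (votingClassifiers H) γ with hF
  have hle : ∀ n : ℕ, FatShatters F (1 / 32 * α * ε * γ) n → n ≤ d := by
    intro n hn
    have : (n : ℕ∞) ≤ fatDim F (1 / 32 * α * ε * γ) :=
      le_iSup₂ (f := fun (n : ℕ) (_ : FatShatters F (1 / 32 * α * ε * γ) n) => (n : ℕ∞)) n hn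
    rw [hfat] at this
    exact_mod_cast this
  have hbd : ∀ f ∈ F, ∀ x, |f x| ≤ γ := by
    rintro f ⟨f0, _, rfl⟩ x
    unfold clip
    rw [abs_le]
    split_ifs with h1 h2
    · constructor <;> linarith
    · constructor <;> linarith
    · constructor <;> linarith
  -- it suffices to exhibit a cover
  have hcov : ∀ (N : Finset (X → ℝ)) (R : ℝ), IsCoverOn xs F (α * γ) N → (N.card : ℝ) ≤ R →
      coveringNumber xs F (α * γ) ≤ ENNReal.ofReal R := by
    intro N R hN hR
    refine (iInf₂_le N hN).trans ?_
    rw [← ENNReal.ofReal_natCast]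
    exact ENNReal.ofReal_le_ofReal hR
  have hαε : α * ε * γ ≤ α * γ := by
    have : 0 < α * γ := by positivity
    nlinarith
  have hαεγ : 0 < α * ε * γ := by positivity
  rcases Nat.eq_zero_or_pos d with hd0 | hd
  · subst hd0
    have hz : Real.exp (50 * ((0 : ℕ) : ℝ) *
        (Real.log (2 * m / (((0 : ℕ) : ℝ) * α))) ^ ((1 : ℝ) + ε)) = 1 := by simp
    rw [hz]
    rcases F.eq_empty_or_nonempty with hE | ⟨f0, hf0⟩
    · exact hcov ∅ 1 (by intro f hf; rw [hE] at hf; exact absurd hf (Set.notMem_empty _)) (by simp)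
    · refine hcov {f0} 1 ?_ (by simp)
      intro f hf
      refine ⟨f0, by simp, fun i => ?_⟩
      by_contra hc
      have key : ∀ f ∈ F, ∀ h ∈ F, ∀ x, α * γ < f x - h x → False := by
        intro f hf h hh x hx
        have : FatShatters F (1 / 32 * α * ε * γ) 1 := by
          refine ⟨fun _ => x, fun _ => (f x + h x) / 2, fun b => ?_⟩
          cases hb : b 0
          · refine ⟨h, hh, fun i => ?_⟩
            rw [Subsingleton.elim i 0, hb]
            exact ⟨fun h => by simp at h, fun _ => by linarith⟩
          · refine ⟨f, hf, fun i => ?_⟩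
            rw [Subsingleton.elim i 0, hb]
            exact ⟨fun _ => by linarith, fun h => by simp at h⟩
        have := hle 1 this
        omega
      rcases lt_abs.mp (not_le.mp hc) with h | h
      · exact key f hf f0 hf0 _ h
      · exact key f0 hf0 f hf (xs i) (by linarith)
  · set L : ℝ := Real.log (2 * m / (d * α)) with hL
    obtain ⟨K, hK⟩ : ∃ K : ℕ, K = ⌈min (1 / ε) L⌉₊ := ⟨_, rfl⟩
    obtain ⟨Z, hZ⟩ : ∃ Z : ℕ, Z = ⌈4 * (K : ℝ) / α⌉₊ := ⟨_, rfl⟩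
    obtain ⟨hK0, hq, hqK, hfin⟩ := aux_num m d K Z α ε L hd hdm hα hα2 hε hL hK hZ
    set q : ℝ := 3 * L ^ (1 / (K : ℝ)) with hqdef
    have hKr : (0 : ℝ) < K := by exact_mod_cast hK0
    obtain ⟨g, hg⟩ : ∃ g : ℝ, g = α * γ / (2 * K) := ⟨_, rfl⟩
    have hZγ : γ ≤ g / 2 * Z := by
      have h1 : 4 * (K : ℝ) / α ≤ Z := by rw [hZ]; exact Nat.le_ceil _
      have h2 : g / 2 * (4 * (K : ℝ) / α) = γ := by rw [hg]; field_simp; norm_num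
      have hg0 : 0 ≤ g / 2 := by rw [hg]; positivity
      have := mul_le_mul_of_nonneg_left h1 hg0
      linarith
    have hKε : (K : ℝ) * ε ≤ 2 := by
      have hpos : 0 ≤ min (1 / ε) L := by
        by_contra h
        have : K = 0 := by rw [hK]; exact Nat.ceil_eq_zero.mpr (not_le.mp h).le
        omega
      have h1 := Nat.ceil_lt_add_one hpos
      rw [← hK] at h1
      have h2 := min_le_left (1 / ε) L
      have h3 : (K : ℝ) ≤ 1 / ε + 1 := by linarith
      have h4 := mul_le_mul_of_nonneg_right h3 hε.le
      have h5 : (1 / ε + 1) * ε = 1 + ε := by field_simp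
      linarith
    have hβ : 1 / 32 * α * ε * γ ≤ g / 4 := by
      rw [hg, div_div, le_div_iff₀ (by positivity)]
      have : 0 < α * γ := by positivity
      nlinarith
    set G : Set (Fin m → ℝ) := (fun f => f ∘ xs) '' F with hG
    have hsh : ∀ (A : Finset (Fin m → ℝ)) W, (∀ f ∈ A, f ∈ G) →
        AuxShat (g / 2) (g / 4) A W → W.card ≤ d := by
      intro A W hA hW
      apply hle
      let e := W.equivFin
      refine ⟨fun k => xs (e.symm k).1.1, fun k => g / 2 * ((e.symm k).1.2 : ℝ), fun b => ?_⟩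
      obtain ⟨f, hf, hfW⟩ := hW (fun p => if h : p ∈ W then b (e ⟨p, h⟩) else true)
      obtain ⟨f0, hf0, rfl⟩ := hA f hf
      refine ⟨f0, hf0, fun k => ?_⟩
      have hk := hfW (e.symm k).1 (e.symm k).2
      have hb : (if h : (e.symm k).1 ∈ W then b (e ⟨(e.symm k).1, h⟩) else true) = b k := by
        rw [dif_pos (e.symm k).2]; simp
      simp only [hb, Function.comp] at hk
      exact ⟨fun h => by linarith [hk.1 h], fun h => by linarith [hk.2 h]⟩
    obtain ⟨N, hN, hNc⟩ := aux_cover G (α * γ) q γ d K Z (by positivity) hq hK0 g hg hZγ hd hdm hqK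
      (by rintro f ⟨f0, hf0, rfl⟩ i; exact hbd f0 hf0 _) hsh _ rfl
    classical
    let Ψ : (Fin m → ℝ) → (X → ℝ) := fun h x =>
      if hx : ∃ i, xs i = x then h hx.choose else 0
    refine hcov (N.image Ψ) _ ?_ ((Nat.cast_le.mpr Finset.card_image_le).trans (hNc.trans hfin))
    intro f hf
    obtain ⟨h, hh, hfh⟩ := hN (f ∘ xs) ⟨f, hf, rfl⟩
    refine ⟨Ψ h, Finset.mem_image_of_mem _ hh, fun i => ?_⟩
    have hx : ∃ j, xs j = xs i := ⟨i, rfl⟩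
    have e : Ψ h (xs i) = h hx.choose := by simp only [Ψ]; rw [dif_pos hx]
    have h2 := hfh hx.choose
    rw [Function.comp, hx.choose_spec] at h2
    rw [e]
    exact h2
end

section
/- There exists a universal constant C ≥ 1 such that: for any 0 < γ ≤ 1, any β > 0 and any hypothesis class H ⊆ {-1,1}^X of VC-dimension d, the fat shattering dimension of the clipped convex hull satisfies fat_β(Δ(H)_⌈γ⌉) ≤ C·d/β². -/
open MeasureTheory
open scoped ENNReal

namespace FatAux

def sg (b : Bool) : ℝ := if b then 1 else -1

def SP {n : ℕ} (d : ℕ) (V : Finset (Fin n → Bool)) : Prop :=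
  ∀ (m : ℕ) (φ : Fin m → Fin n),
    (V.image (fun u => u ∘ φ)).card ≤ ∑ i ∈ Finset.range (d + 1), m.choose i

lemma sauer_num (d q : ℕ) (hq : 1 ≤ q) :
    ((∑ i ∈ Finset.range (d + 1), (q * d).choose i : ℕ) : ℝ) ≤ (Real.exp 1 * q) ^ d := by
  have hq' : (1:ℝ) ≤ q := by exact_mod_cast hq
  have hq0 : (0:ℝ) < q := by linarith
  have h1 : ((∑ i ∈ Finset.range (d + 1), (q * d).choose i : ℕ) : ℝ)
      ≤ q ^ d * ∑ i ∈ Finset.range (q * d + 1), ((q:ℝ)⁻¹) ^ i * ((q * d).choose i : ℝ) := by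
    rw [Finset.mul_sum]
    push_cast
    have : d + 1 ≤ q * d + 1 := by nlinarith
    refine le_trans (Finset.sum_le_sum (g := fun i => (q:ℝ) ^ d * (((q:ℝ)⁻¹) ^ i * ((q * d).choose i : ℝ))) ?_)
      (Finset.sum_le_sum_of_subset_of_nonneg (Finset.range_subset_range.2 this) (fun i _ _ => by positivity))
    intro i hi
    have hi : i ≤ d := by simp at hi; omega
    have : (1:ℝ) ≤ q ^ d * ((q:ℝ)⁻¹) ^ i := by
      rw [inv_pow, ← div_eq_mul_inv, le_div_iff₀ (by positivity), one_mul]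
      exact pow_le_pow_right₀ hq' hi
    rw [← mul_assoc]
    exact le_mul_of_one_le_left (by positivity) this
  have h2 : ∑ i ∈ Finset.range (q * d + 1), ((q:ℝ)⁻¹) ^ i * ((q * d).choose i : ℝ)
      = ((q:ℝ)⁻¹ + 1) ^ (q * d) := by
    rw [add_pow]; simp
  have h3 : ((q:ℝ)⁻¹ + 1) ^ (q * d) ≤ Real.exp 1 ^ d := by
    rw [pow_mul]
    apply pow_le_pow_left₀ (by positivity)
    calc ((q:ℝ)⁻¹ + 1) ^ q ≤ (Real.exp (q:ℝ)⁻¹) ^ q :=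
          pow_le_pow_left₀ (by positivity) (Real.add_one_le_exp _) _
      _ = Real.exp 1 := by rw [← Real.exp_nat_mul]; congr 1; field_simp
  calc _ ≤ _ := h1
    _ ≤ q ^ d * Real.exp 1 ^ d := by rw [h2]; gcongr
    _ = _ := by rw [mul_pow]; ring

lemma num_step (k : ℕ) : Real.exp 1 * ((12 * (k + 1) * 4 ^ k : ℕ) : ℝ) < 64 ^ (k + 1) := by
  have h1 : Real.exp 1 < 3 := by have := Real.exp_one_lt_d9; linarith
  have h2 : ((k + 1 : ℕ) : ℝ) ≤ 2 ^ k := by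
    exact_mod_cast (Nat.lt_two_pow_self (n := k))
  have h3 : (64:ℝ) ^ (k + 1) = 64 * (8 ^ k * 2 ^ k * 4 ^ k) := by
    rw [← mul_pow, ← mul_pow, pow_succ]; norm_num; ring
  have h4 : (1:ℝ) ≤ 8 ^ k := one_le_pow₀ (by norm_num)
  have h5 : (0:ℝ) < 4 ^ k := by positivity
  have h6 : (0:ℝ) < 2 ^ k := by positivity
  push_cast at h2 ⊢
  rw [h3]
  have hA : (12 * ((k:ℝ) + 1) * 4 ^ k) ≤ 12 * 2 ^ k * 4 ^ k := by gcongr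
  have hB : (0:ℝ) < 12 * ((k:ℝ) + 1) * 4 ^ k := by positivity
  have hC : (0:ℝ) < 2 ^ k * 4 ^ k := by positivity
  calc _ < 3 * (12 * ((k:ℝ) + 1) * 4 ^ k) := by gcongr
    _ ≤ 3 * (12 * 2 ^ k * 4 ^ k) := by gcongr
    _ ≤ 64 * (1 * 2 ^ k * 4 ^ k) := by nlinarith
    _ ≤ _ := by gcongr

lemma count_agree {n : ℕ} (u v : Fin n → Bool) (m : ℕ) :
    (Finset.univ.filter (fun φ : Fin m → Fin n => u ∘ φ = v ∘ φ)).card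
      = (n - hammingDist u v) ^ m := by
  have : (Finset.univ.filter (fun φ : Fin m → Fin n => u ∘ φ = v ∘ φ))
      = Fintype.piFinset (fun _ : Fin m => Finset.univ.filter (fun i => u i = v i)) := by
    ext φ
    simp [funext_iff]
  rw [this, Fintype.card_piFinset]
  simp only [Finset.prod_const, Finset.card_univ, Fintype.card_fin]
  congr 1
  have h := Finset.card_filter_add_card_filter_not (s := (Finset.univ : Finset (Fin n))) (fun i => u i = v i)
  simp only [Finset.card_univ, Fintype.card_fin] at h
  unfold hammingDist
  simp only [ne_eq]
  omega

lemma packing {n d k : ℕ} (hn : 0 < n) (hd : 1 ≤ d) (V S : Finset (Fin n → Bool)) (hV : SP d V)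
    (hS : S ⊆ V) (hsep : ∀ u ∈ S, ∀ v ∈ S, u ≠ v → n ≤ 4 ^ k * hammingDist u v) :
    S.card ≤ 64 ^ (d * (k + 1)) := by
  by_contra hcon
  push Not at hcon
  obtain ⟨T, hTS, hT⟩ := Finset.exists_subset_card_eq hcon.le
  set q := 12 * (k + 1) * 4 ^ k with hq
  set m := q * d with hm
  -- a good sample exists
  have hgood : ∃ φ : Fin m → Fin n, ∀ u ∈ T, ∀ v ∈ T, u ≠ v → u ∘ φ ≠ v ∘ φ := by
    by_contra hno
    push Not at hno
    have hcover : (Finset.univ : Finset (Fin m → Fin n)) ⊆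
        (T.offDiag).biUnion (fun p => Finset.univ.filter (fun φ : Fin m → Fin n => p.1 ∘ φ = p.2 ∘ φ)) := by
      intro φ _
      obtain ⟨u, hu, v, hv, huv, h⟩ := hno φ
      simp only [Finset.mem_biUnion, Finset.mem_offDiag, Finset.mem_filter, Finset.mem_univ, true_and]
      exact ⟨(u, v), ⟨hu, hv, huv⟩, h⟩
    have hc := (Finset.card_le_card hcover).trans Finset.card_biUnion_le
    simp only [Finset.card_univ, Fintype.card_fun, Fintype.card_fin, count_agree] at hc
    have hc' : ((n:ℝ)) ^ m ≤ ∑ p ∈ T.offDiag, (((n - hammingDist p.1 p.2 : ℕ) : ℝ)) ^ m := by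
      exact_mod_cast hc
    have hterm : ∀ p ∈ T.offDiag, (((n - hammingDist p.1 p.2 : ℕ) : ℝ)) ^ m
        ≤ n ^ m * Real.exp (-(12 * (d * (k + 1)) : ℕ)) := by
      intro p hp
      rw [Finset.mem_offDiag] at hp
      have h1 := hsep _ (hTS hp.1) _ (hTS hp.2.1) hp.2.2
      have h1' : (n:ℝ) ≤ 4 ^ k * (hammingDist p.1 p.2 : ℝ) := by exact_mod_cast h1
      have hle : hammingDist p.1 p.2 ≤ n := by
        simpa using hammingDist_le_card_fintype (x := p.1) (y := p.2)
      rw [Nat.cast_sub hle]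
      have h4 : (0:ℝ) < 4 ^ k := by positivity
      have h2 : (n:ℝ) - hammingDist p.1 p.2 ≤ n * Real.exp (-(1 / 4 ^ k)) := by
        have h3 := Real.one_sub_le_exp_neg (1 / (4:ℝ) ^ k)
        have h5 : (n:ℝ) / 4 ^ k ≤ hammingDist p.1 p.2 := by
          rw [div_le_iff₀ h4]; linarith
        calc (n:ℝ) - hammingDist p.1 p.2 ≤ n * (1 - 1 / 4 ^ k) := by
              rw [mul_sub, mul_one, mul_one_div]; linarith
          _ ≤ _ := by gcongr
      have h0 : (0:ℝ) ≤ (n:ℝ) - hammingDist p.1 p.2 := by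
        rw [sub_nonneg]; exact_mod_cast hle
      calc _ ≤ (n * Real.exp (-(1 / 4 ^ k))) ^ m := pow_le_pow_left₀ h0 h2 m
        _ = _ := by
          rw [mul_pow, ← Real.exp_nat_mul]
          congr 2
          rw [hm, hq]; push_cast; field_simp
    have hsum := hc'.trans (Finset.sum_le_sum hterm)
    rw [Finset.sum_const, nsmul_eq_mul] at hsum
    have hoff : ((T.offDiag).card : ℝ) ≤ (2:ℝ) ^ (12 * (d * (k + 1))) := by
      have : T.offDiag.card ≤ 2 ^ (12 * (d * (k + 1))) := by
        rw [Finset.offDiag_card, hT]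
        refine (Nat.sub_le _ _).trans (le_of_eq ?_)
        rw [← mul_pow, pow_mul 2 12]; norm_num
      exact_mod_cast this
    have hexp : (2:ℝ) ^ (12 * (d * (k + 1))) * Real.exp (-(12 * (d * (k + 1)) : ℕ)) < 1 := by
      rw [Real.exp_neg, ← div_eq_mul_inv, div_lt_one (Real.exp_pos _)]
      rw [← mul_one (((12 * (d * (k + 1)) : ℕ)) : ℝ), Real.exp_nat_mul]
      apply pow_lt_pow_left₀ _ (by norm_num) (by positivity)
      have := Real.exp_one_gt_d9; linarith
    have hnm : (0:ℝ) < (n:ℝ) ^ m := by positivity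
    have : (n:ℝ) ^ m ≤ n ^ m * ((2:ℝ) ^ (12 * (d * (k + 1))) * Real.exp (-(12 * (d * (k + 1)) : ℕ))) := by
      refine hsum.trans ?_
      have : (0:ℝ) < Real.exp (-(12 * (d * (k + 1)) : ℕ)) := Real.exp_pos _
      calc _ ≤ (2:ℝ) ^ (12 * (d * (k + 1))) * ((n:ℝ) ^ m * Real.exp (-(12 * (d * (k + 1)) : ℕ))) := by gcongr
        _ = _ := by ring
    nlinarith
  obtain ⟨φ, hφ⟩ := hgood
  have hcard : (T.image (fun u => u ∘ φ)).card = T.card := by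
    apply Finset.card_image_of_injOn
    intro u hu v hv h
    by_contra hne
    exact hφ u hu v hv hne h
  have h1 : T.card ≤ ∑ i ∈ Finset.range (d + 1), m.choose i := by
    rw [← hcard]
    exact (Finset.card_le_card (Finset.image_subset_image (hTS.trans hS))).trans (hV m φ)
  have hq1 : 1 ≤ q := by rw [hq]; exact Nat.one_le_iff_ne_zero.2 (by positivity)
  have h2 := sauer_num d q hq1
  have h3 : ((T.card : ℕ) : ℝ) ≤ (Real.exp 1 * q) ^ d := le_trans (by exact_mod_cast h1) h2
  rw [hT] at h3
  have h4 : (Real.exp 1 * q) ^ d < (64 ^ (k + 1)) ^ d :=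
    pow_lt_pow_left₀ (num_step k) (by positivity) (by omega)
  rw [← pow_mul, mul_comm (k+1) d] at h4
  push_cast at h3
  linarith

lemma sp_of_vc {X : Type} (H : Set (X → ℝ)) (d : ℕ)
    (hvc : ∀ s : Finset X, ShattersPM H s → s.card ≤ d) {n : ℕ} (x : Fin n → X)
    (V : Finset (Fin n → Bool))
    (hV : ∀ u ∈ V, ∃ h ∈ H, ∀ i, h (x i) = sg (u i)) : SP d V := by
  classical
  intro m φ
  set A : Finset (Finset (Fin m)) := (V.image (fun u => u ∘ φ)).image
    (fun w => Finset.univ.filter (fun j => w j = true)) with hA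
  have hcA : A.card = (V.image (fun u => u ∘ φ)).card := by
    apply Finset.card_image_of_injective
    intro w w' h
    funext j
    have := Finset.ext_iff.1 h j
    simp only [Finset.mem_filter, Finset.mem_univ, true_and] at this
    exact Bool.eq_iff_iff.2 this
  have hvcd : A.vcDim ≤ d := by
    unfold Finset.vcDim
    apply Finset.sup_le
    intro J hJ
    rw [Finset.mem_shatterer] at hJ
    have key : ∀ t ⊆ J, ∃ h ∈ H, ∀ j ∈ J, h (x (φ j)) = if j ∈ t then 1 else -1 := by
      intro t ht
      obtain ⟨w, hw, hwt⟩ := hJ ht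
      simp only [hA, Finset.mem_image] at hw
      obtain ⟨_, ⟨u, hu, rfl⟩, rfl⟩ := hw
      obtain ⟨h, hh, hhu⟩ := hV u hu
      refine ⟨h, hh, fun j hj => ?_⟩
      rw [hhu]
      have : j ∈ t ↔ u (φ j) = true := by
        rw [← hwt]; simp [hj]
      simp only [sg, this]
    have hinj : Set.InjOn (fun j => x (φ j)) (J : Set (Fin m)) := by
      intro j hj j' hj' he
      by_contra hne
      obtain ⟨h, _, hh⟩ := key {j} (by simpa using hj)
      have h1 := hh j hj
      have h2 := hh j' hj'
      simp only at he
      rw [he] at h1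
      rw [h1] at h2
      simp [Ne.symm hne] at h2
      norm_num at h2
    rw [← Finset.card_image_of_injOn hinj]
    apply hvc
    intro b hb
    obtain ⟨h, hh, hhj⟩ := key (J.filter (fun j => b (x (φ j)) = 1)) (Finset.filter_subset _ _)
    refine ⟨h, hh, ?_⟩
    intro y hy
    obtain ⟨j, hj, rfl⟩ := Finset.mem_image.1 hy
    rw [hhj j hj]
    simp only [Finset.mem_filter, hj, true_and]
    split_ifs with h1
    · exact h1.symm
    · exact ((hb _).resolve_left h1).symm
  rw [← hcA]
  calc A.card ≤ A.shatterer.card := Finset.card_le_card_shatterer A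
    _ ≤ ∑ k ∈ Finset.Iic A.vcDim, (Fintype.card (Fin m)).choose k := Finset.card_shatterer_le_sum_vcDim
    _ ≤ ∑ i ∈ Finset.range (d + 1), m.choose i := by
      rw [Fintype.card_fin]
      apply Finset.sum_le_sum_of_subset
      intro i hi
      simp at hi ⊢
      omega


def ip {n : ℕ} (σ u : Fin n → Bool) : ℝ := ∑ i, sg (σ i) * sg (u i)

lemma mgf {n : ℕ} (u v : Fin n → Bool) (l : ℝ) :
    ∑ σ : Fin n → Bool, Real.exp (l * (ip σ u - ip σ v))
      ≤ 2 ^ n * Real.exp (2 * l ^ 2 * hammingDist u v) := by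
  have h1 : ∀ σ : Fin n → Bool, Real.exp (l * (ip σ u - ip σ v))
      = ∏ i, Real.exp (l * (sg (σ i) * (sg (u i) - sg (v i)))) := by
    intro σ
    rw [← Real.exp_sum, ip, ip, ← Finset.sum_sub_distrib, Finset.mul_sum]
    congr 1
    exact Finset.sum_congr rfl (fun i _ => by ring)
  simp_rw [h1]
  rw [← Fintype.prod_sum (fun i b => Real.exp (l * (sg b * (sg (u i) - sg (v i)))))]
  have h2 : ∀ i : Fin n, ∑ b, Real.exp (l * (sg b * (sg (u i) - sg (v i))))
      ≤ 2 * Real.exp (if u i ≠ v i then 2 * l ^ 2 else 0) := by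
    intro i
    have h3 := Real.cosh_le_exp_half_sq (l * (sg (u i) - sg (v i)))
    rw [Real.cosh_eq] at h3
    have h4 : (l * (sg (u i) - sg (v i))) ^ 2 / 2 = (if u i ≠ v i then 2 * l ^ 2 else 0) := by
      cases u i <;> cases v i <;> simp [sg] <;> ring
    rw [h4] at h3
    simp only [Fintype.sum_bool, sg, if_true, Bool.false_eq_true, if_false] at h3 ⊢
    rw [show ∀ y : ℝ, l * (1 * y) = l * y by intro y; ring,
      show ∀ y : ℝ, l * (-1 * y) = -(l * y) by intro y; ring]
    linarith
  calc _ ≤ ∏ i : Fin n, (2 * Real.exp (if u i ≠ v i then 2 * l ^ 2 else 0)) :=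
        Finset.prod_le_prod (fun i _ => Finset.sum_nonneg (fun b _ => (Real.exp_pos _).le)) (fun i _ => h2 i)
    _ = _ := by
      rw [Finset.prod_mul_distrib, ← Real.exp_sum, ← Finset.sum_filter]
      simp only [Finset.prod_const, Finset.card_univ, Fintype.card_fin, Finset.sum_const, nsmul_eq_mul]
      unfold hammingDist
      rw [mul_comm (2 * l ^ 2)]

lemma exists_net {n : ℕ} (k : ℕ) (V : Finset (Fin n → Bool)) :
    ∃ S ⊆ V, (∀ u ∈ S, ∀ v ∈ S, u ≠ v → n ≤ 4 ^ k * hammingDist u v) ∧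
      ∀ u ∈ V, ∃ v ∈ S, u = v ∨ 4 ^ k * hammingDist u v < n := by
  classical
  obtain ⟨S, hS, hmax⟩ := Finset.exists_max_image
    (V.powerset.filter (fun S => ∀ u ∈ S, ∀ v ∈ S, u ≠ v → n ≤ 4 ^ k * hammingDist u v))
    Finset.card ⟨∅, by simp⟩
  rw [Finset.mem_filter, Finset.mem_powerset] at hS
  refine ⟨S, hS.1, hS.2, fun u hu => ?_⟩
  by_contra hno
  push Not at hno
  have huS : u ∉ S := fun h => (hno u h).1 rfl
  have := hmax (insert u S) (by
    rw [Finset.mem_filter, Finset.mem_powerset]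
    refine ⟨Finset.insert_subset hu hS.1, ?_⟩
    intro a ha b hb hab
    rw [Finset.mem_insert] at ha hb
    rcases ha with rfl | ha <;> rcases hb with rfl | hb
    · exact absurd rfl hab
    · exact (hno b hb).2
    · rw [hammingDist_comm]; exact (hno a ha).2
    · exact hS.2 a ha b hb hab)
  rw [Finset.card_insert_of_notMem huS] at this
  omega

lemma good_sign {n d : ℕ} (hn : 0 < n) (hd : 1 ≤ d) (K : ℕ)
    (W : ℕ → Finset (Fin n → Bool)) (p : ℕ → (Fin n → Bool) → (Fin n → Bool))
    (hW : ∀ k, (W k).card ≤ 64 ^ (d * (k + 2)))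
    (hp : ∀ k, ∀ u ∈ W k, 4 ^ k * hammingDist u (p k u) ≤ n) :
    ∃ σ : Fin n → Bool, ∀ k < K, ∀ u ∈ W k,
      |ip σ u - ip σ (p k u)| ≤ 7 * (k + 2) * (1 / 2) ^ k * Real.sqrt (n * d) := by
  classical
  by_contra hno
  push Not at hno
  have hn' : (0:ℝ) < n := by exact_mod_cast hn
  have hd' : (1:ℝ) ≤ d := by exact_mod_cast hd
  set l : ℕ → ℝ := fun k => 7 * (k + 2) / 4 * 2 ^ k * Real.sqrt (d / n) with hl
  set t : ℕ → ℝ := fun k => 7 * (k + 2) * (1 / 2) ^ k * Real.sqrt (n * d) with ht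
  have hl0 : ∀ k, 0 ≤ l k := fun k => by simp only [hl]; positivity
  have hlt : ∀ k, l k * t k = 49 * (k + 2) ^ 2 / 4 * d := by
    intro k
    have h1 : Real.sqrt (d / n) * Real.sqrt (n * d) = d := by
      rw [← Real.sqrt_mul (by positivity), show (d:ℝ) / n * (n * d) = d ^ 2 by field_simp,
        Real.sqrt_sq (by positivity)]
    have h2 : (2:ℝ) ^ k * (1 / 2) ^ k = 1 := by rw [← mul_pow]; norm_num
    calc l k * t k = 49 * (k + 2) ^ 2 / 4 * (2 ^ k * (1 / 2) ^ k) * (Real.sqrt (d / n) * Real.sqrt (n * d)) := by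
          simp only [hl, ht]; ring
      _ = _ := by rw [h1, h2]; ring
  have hl2 : ∀ k, l k ^ 2 = 49 * (k + 2) ^ 2 / 16 * 4 ^ k * (d / n) := by
    intro k
    have h3 : ((2:ℝ) ^ k) ^ 2 = 4 ^ k := by rw [← pow_mul, mul_comm, pow_mul]; norm_num
    simp only [hl]
    rw [mul_pow, mul_pow, Real.sq_sqrt (by positivity), h3]; ring
  -- total potential
  set G : (Fin n → Bool) → ℝ := fun σ => ∑ k ∈ Finset.range K, ∑ u ∈ W k,
    (Real.exp (l k * (ip σ u - ip σ (p k u))) + Real.exp (l k * (ip σ (p k u) - ip σ u)))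
      * Real.exp (-(l k * t k)) with hG
  have hlow : ∀ σ, 1 ≤ G σ := by
    intro σ
    obtain ⟨k, hk, u, hu, h⟩ := hno σ
    have h : t k < |ip σ u - ip σ (p k u)| := h
    have hterm : 1 ≤ (Real.exp (l k * (ip σ u - ip σ (p k u))) + Real.exp (l k * (ip σ (p k u) - ip σ u)))
      * Real.exp (-(l k * t k)) := by
      rw [add_mul, ← Real.exp_add, ← Real.exp_add]
      rcases lt_abs.1 h with h | h
      · have := Real.one_le_exp (x := l k * (ip σ u - ip σ (p k u)) + -(l k * t k))
          (by nlinarith [hl0 k])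
        have := Real.exp_pos (l k * (ip σ (p k u) - ip σ u) + -(l k * t k))
        linarith
      · have := Real.one_le_exp (x := l k * (ip σ (p k u) - ip σ u) + -(l k * t k))
          (by nlinarith [hl0 k])
        have := Real.exp_pos (l k * (ip σ u - ip σ (p k u)) + -(l k * t k))
        linarith
    refine hterm.trans ?_
    have hpos : ∀ k u, 0 ≤ (Real.exp (l k * (ip σ u - ip σ (p k u))) + Real.exp (l k * (ip σ (p k u) - ip σ u)))
      * Real.exp (-(l k * t k)) := fun k u => by positivity
    refine le_trans ?_ (Finset.single_le_sum (f := fun k => ∑ u ∈ W k,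
      (Real.exp (l k * (ip σ u - ip σ (p k u))) + Real.exp (l k * (ip σ (p k u) - ip σ u)))
      * Real.exp (-(l k * t k))) (fun k _ => Finset.sum_nonneg (fun u _ => hpos k u)) (Finset.mem_range.2 hk))
    exact Finset.single_le_sum (f := fun u => 
      (Real.exp (l k * (ip σ u - ip σ (p k u))) + Real.exp (l k * (ip σ (p k u) - ip σ u)))
      * Real.exp (-(l k * t k))) (fun u _ => hpos k u) hu
  have hsumlow : (2:ℝ) ^ n ≤ ∑ σ, G σ := by
    calc (2:ℝ) ^ n = ∑ σ : Fin n → Bool, (1:ℝ) := by simp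
      _ ≤ _ := Finset.sum_le_sum (fun σ _ => hlow σ)
  have hone : ∀ k, ∀ u ∈ W k, ∑ σ : Fin n → Bool,
      (Real.exp (l k * (ip σ u - ip σ (p k u))) + Real.exp (l k * (ip σ (p k u) - ip σ u)))
      * Real.exp (-(l k * t k)) ≤ 2 ^ n * (2 * Real.exp (-(49 * (k + 2) ^ 2 / 8 * d))) := by
    intro k u hu
    rw [← Finset.sum_mul, Finset.sum_add_distrib]
    have h1 := mgf u (p k u) (l k)
    have h2 := mgf (p k u) u (l k)
    rw [hammingDist_comm] at h2
    have h3 : 2 * l k ^ 2 * (hammingDist u (p k u) : ℝ) ≤ 49 * (k + 2) ^ 2 / 8 * d := by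
      have h4 : (4:ℝ) ^ k * (hammingDist u (p k u) : ℝ) ≤ n := by exact_mod_cast hp k u hu
      rw [hl2]
      calc 2 * (49 * ((k:ℝ) + 2) ^ 2 / 16 * 4 ^ k * (d / n)) * (hammingDist u (p k u) : ℝ)
          = 49 * ((k:ℝ) + 2) ^ 2 / 8 * (d / n) * (4 ^ k * (hammingDist u (p k u) : ℝ)) := by ring
        _ ≤ 49 * ((k:ℝ) + 2) ^ 2 / 8 * (d / n) * n := by gcongr
        _ = _ := by field_simp
    have h5 := Real.exp_le_exp.2 h3
    have h6 : (0:ℝ) < 2 ^ n := by positivity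
    calc _ ≤ (2 ^ n * Real.exp (49 * (k + 2) ^ 2 / 8 * d) + 2 ^ n * Real.exp (49 * (k + 2) ^ 2 / 8 * d))
          * Real.exp (-(l k * t k)) := by
            apply mul_le_mul_of_nonneg_right _ (Real.exp_pos _).le
            nlinarith
      _ = 2 ^ n * (2 * (Real.exp (49 * (k + 2) ^ 2 / 8 * d) * Real.exp (-(l k * t k)))) := by ring
      _ = _ := by
        rw [← Real.exp_add, hlt]
        congr 3; ring
  have hk : ∀ k, ((W k).card : ℝ) * (2 * Real.exp (-(49 * (k + 2) ^ 2 / 8 * d))) ≤ (1/2) ^ (k + 1) := by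
    intro k
    have h1 : ((W k).card : ℝ) ≤ 64 ^ (d * (k + 2)) := by exact_mod_cast hW k
    have he : (2:ℝ) ≤ Real.exp 1 := by have := Real.exp_one_gt_d9; linarith
    have h2 : (64:ℝ) ^ (d * (k + 2)) ≤ Real.exp (6 * (d * (k + 2))) := by
      calc (64:ℝ) ^ (d * (k + 2)) = (2 ^ 6) ^ (d * (k + 2)) := by norm_num
        _ ≤ (Real.exp 1 ^ 6) ^ (d * (k + 2)) := by gcongr
        _ = _ := by
          rw [← pow_mul, ← Real.exp_nat_mul]; congr 1; push_cast; ring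
    have h3 : (2:ℝ) ^ (k + 2) ≤ Real.exp (k + 2) := by
      calc (2:ℝ) ^ (k + 2) ≤ (Real.exp 1) ^ (k + 2) := by gcongr
        _ = _ := by rw [← Real.exp_nat_mul]; congr 1; push_cast; ring
    have h4 : Real.exp (6 * (d * (k + 2))) * Real.exp (-(49 * (k + 2) ^ 2 / 8 * d)) ≤ Real.exp (-(k + 2)) := by
      rw [← Real.exp_add]
      apply Real.exp_le_exp.2
      have hk0 : (0:ℝ) ≤ k := by positivity
      have : ((k:ℝ) + 2) * 1 ≤ (k + 2) * d := by gcongr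
      have : 0 ≤ ((k:ℝ) + 2) * d * k := by positivity
      nlinarith
    calc _ ≤ Real.exp (6 * (d * (k + 2))) * (2 * Real.exp (-(49 * (k + 2) ^ 2 / 8 * d))) := by
          gcongr; exact h1.trans h2
      _ = 2 * (Real.exp (6 * (d * (k + 2))) * Real.exp (-(49 * (k + 2) ^ 2 / 8 * d))) := by ring
      _ ≤ 2 * Real.exp (-(k + 2)) := by gcongr
      _ ≤ 2 * ((2:ℝ) ^ (k + 2))⁻¹ := by rw [Real.exp_neg]; gcongr
      _ = _ := by rw [one_div, inv_pow, pow_succ 2 (k+1)]; field_simp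
  have hgeom : ∑ k ∈ Finset.range K, ((1:ℝ)/2) ^ (k + 1) < 1 := by
    have : ∀ K : ℕ, ∑ k ∈ Finset.range K, ((1:ℝ)/2) ^ (k + 1) = 1 - (1/2) ^ K := by
      intro K
      induction K with
      | zero => simp
      | succ K ih => rw [Finset.sum_range_succ, ih]; ring
    rw [this]
    have : (0:ℝ) < (1/2) ^ K := by positivity
    linarith
  have hsumup : ∑ σ, G σ ≤ 2 ^ n * ∑ k ∈ Finset.range K, ((1:ℝ)/2) ^ (k + 1) := by
    simp only [hG]
    rw [Finset.sum_comm, Finset.mul_sum]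
    apply Finset.sum_le_sum
    intro k _
    rw [Finset.sum_comm]
    calc _ ≤ ∑ u ∈ W k, 2 ^ n * (2 * Real.exp (-(49 * (k + 2) ^ 2 / 8 * d))) :=
          Finset.sum_le_sum (hone k)
      _ = 2 ^ n * (((W k).card : ℝ) * (2 * Real.exp (-(49 * (k + 2) ^ 2 / 8 * d)))) := by
          rw [Finset.sum_const, nsmul_eq_mul]; ring
      _ ≤ _ := by gcongr; exact hk k
  have h6 : (0:ℝ) < 2 ^ n := by positivity
  nlinarith

lemma chain {n d : ℕ} (hn : 0 < n) (V : Finset (Fin n → Bool)) (hV : SP d V)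
    (h0 : Fin n → Bool) (h0V : h0 ∈ V) :
    ∃ σ : Fin n → Bool, ∀ u ∈ V, |ip σ u - ip σ h0| ≤ 42 * Real.sqrt (n * d) := by
  classical
  rcases Nat.eq_zero_or_pos d with rfl | hd
  · have h := hV n id
    simp only [zero_add, Finset.range_one, Finset.sum_singleton, Nat.choose_zero_right] at h
    have h : V.card ≤ 1 := by simpa using h
    rw [Finset.card_le_one] at h
    refine ⟨h0, fun u hu => ?_⟩
    rw [h u hu h0 h0V]; simp
  choose S hSV hSsep hSnet using fun k => exists_net k V
  -- parents
  have hpar : ∀ k (u : Fin n → Bool), ∃ v, u ∈ V → 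
      (v ∈ (if k = 0 then {h0} else S k)) ∧ 4 ^ k * hammingDist u v ≤ n := by
    intro k u
    by_cases hu : u ∈ V
    · rcases Nat.eq_zero_or_pos k with rfl | hk
      · refine ⟨h0, fun _ => ⟨by simp, ?_⟩⟩
        simpa using hammingDist_le_card_fintype (x := u) (y := h0)
      · obtain ⟨v, hv, h⟩ := hSnet k u hu
        refine ⟨v, fun _ => ⟨by simpa [hk.ne'] using hv, ?_⟩⟩
        rcases h with rfl | h
        · simp
        · exact h.le
    · exact ⟨u, fun h => absurd h hu⟩
  choose p hp using hpar
  obtain ⟨σ, hσ⟩ := good_sign hn hd n (fun k => S (k + 1)) p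
    (fun k => packing hn hd V _ hV (hSV _) (hSsep _))
    (fun k u hu => (hp k u (hSV _ hu)).2)
  refine ⟨σ, ?_⟩
  have hind : ∀ k ≤ n, ∀ u ∈ (if k = 0 then {h0} else S k),
      |ip σ u - ip σ h0| ≤ 7 * (6 - (2 * k + 6) * (1/2)^k) * Real.sqrt (n * d) := by
    intro k
    induction k with
    | zero => intro _ u hu; simp at hu; subst hu; simp
    | succ k ih =>
      intro hk u hu
      have hu : u ∈ S (k + 1) := by simpa using hu
      have h1 := hσ k (by omega) u hu
      have h2 := ih (by omega) (p k u) (hp k u (hSV _ hu)).1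
      calc |ip σ u - ip σ h0| ≤ |ip σ u - ip σ (p k u)| + |ip σ (p k u) - ip σ h0| := abs_sub_le _ _ _
        _ ≤ _ := add_le_add h1 h2
        _ = _ := by push_cast; ring
  intro u hu
  have huS : u ∈ S n := by
    obtain ⟨v, hv, h⟩ := hSnet n u hu
    rcases h with rfl | h
    · exact hv
    · have h4 : n < 4 ^ n := Nat.lt_pow_self (by norm_num)
      have : hammingDist u v = 0 := by
        by_contra hne
        have : 4 ^ n * 1 ≤ 4 ^ n * hammingDist u v := Nat.mul_le_mul_left _ (Nat.one_le_iff_ne_zero.2 hne)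
        omega
      rw [eq_of_hammingDist_eq_zero this]; exact hv
  refine (hind n le_rfl u (by simpa [hn.ne'] using huS)).trans ?_
  apply mul_le_mul_of_nonneg_right _ (Real.sqrt_nonneg _)
  have : (0:ℝ) ≤ (2 * n + 6) * (1/2)^n := by positivity
  linarith

lemma clip_ge {X : Type} {γ r β : ℝ} {f : X → ℝ} {x : X} (h : r + β ≤ clip γ f x)
    (h1 : -γ < r + β) : r + β ≤ f x := by
  unfold clip at h
  split_ifs at h <;> linarith

lemma clip_le {X : Type} {γ r β : ℝ} {f : X → ℝ} {x : X} (h : clip γ f x ≤ r - β)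
    (h1 : r - β < γ) : f x ≤ r - β := by
  unfold clip at h
  split_ifs at h <;> linarith

lemma clip_mem {X : Type} {γ : ℝ} (hγ : 0 < γ) (f : X → ℝ) (x : X) :
    -γ ≤ clip γ f x ∧ clip γ f x ≤ γ := by
  unfold clip
  split_ifs <;> constructor <;> linarith

end FatAux

/-- Lemma `fathelper` (fat-shattering dimension of the clipped convex hull). -/
theorem stmt_5 :
    ∃ C : ℝ, 1 ≤ C ∧
      ∀ (X : Type) (H : Set (X → ℝ)) (d : ℕ),
        (∀ h ∈ H, ∀ x, h x = 1 ∨ h x = -1) →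
        HasVCDim H d →
        ∀ (γ β : ℝ), 0 < γ → γ ≤ 1 → 0 < β →
        ∀ n : ℕ, FatShatters (clipClass (votingClassifiers H) γ) β n →
          (n : ℝ) ≤ C * d / β ^ 2 := by
  classical
  refine ⟨1764, by norm_num, ?_⟩
  intro X H d hH hvc γ β hγ _ hβ n hfat
  obtain ⟨x, r, hsh⟩ := hfat
  rcases Nat.eq_zero_or_pos n with rfl | hn
  · simp only [Nat.cast_zero]; positivity
  have hn' : (0:ℝ) < n := by exact_mod_cast hn
  -- unclip
  have hunc : ∀ b : Fin n → Bool, ∃ f ∈ votingClassifiers H, ∀ i,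
      (b i = true → r i + β ≤ f (x i)) ∧ (b i = false → f (x i) ≤ r i - β) := by
    have hr : ∀ i, -γ < r i + β ∧ r i - β < γ := by
      intro i
      obtain ⟨_, ⟨f, _, rfl⟩, hf⟩ := hsh (fun _ => true)
      obtain ⟨_, ⟨g, _, rfl⟩, hg⟩ := hsh (fun _ => false)
      have h1 := (hf i).1 rfl
      have h2 := (hg i).2 rfl
      have h3 := FatAux.clip_mem hγ f (x i)
      have h4 := FatAux.clip_mem hγ g (x i)
      constructor <;> linarith
    intro b
    obtain ⟨_, ⟨f, hfv, rfl⟩, hf⟩ := hsh b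
    exact ⟨f, hfv, fun i => ⟨fun h => FatAux.clip_ge ((hf i).1 h) (hr i).1,
      fun h => FatAux.clip_le ((hf i).2 h) (hr i).2⟩⟩
  set tr : (X → ℝ) → (Fin n → Bool) := fun h i => decide (h (x i) = 1) with htr
  have htrs : ∀ h ∈ H, ∀ i, h (x i) = FatAux.sg (tr h i) := by
    intro h hh i
    rcases hH h hh (x i) with h1 | h1
    · simp [htr, FatAux.sg, h1]
    · simp only [htr, FatAux.sg, h1]; norm_num
  set V : Finset (Fin n → Bool) := Finset.univ.filter (fun u => ∃ h ∈ H, tr h = u) with hVd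
  have hV : FatAux.SP d V := by
    apply FatAux.sp_of_vc H d hvc.2 x
    intro u hu
    simp only [hVd, Finset.mem_filter, Finset.mem_univ, true_and] at hu
    obtain ⟨h, hh, rfl⟩ := hu
    exact ⟨h, hh, htrs h hh⟩
  have hVm : ∀ h ∈ H, tr h ∈ V := by
    intro h hh
    simp only [hVd, Finset.mem_filter, Finset.mem_univ, true_and]
    exact ⟨h, hh, rfl⟩
  obtain ⟨s, hs, -⟩ := hvc.1
  obtain ⟨h0, hh0, -⟩ := hs (fun _ => 1) (fun _ => Or.inl rfl)
  obtain ⟨σ, hσ⟩ := FatAux.chain hn V hV (tr h0) (hVm h0 hh0)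
  set c := FatAux.ip σ (tr h0) with hc
  set B := 42 * Real.sqrt (n * d) with hB
  have hvote : ∀ f ∈ votingClassifiers H, |∑ i, FatAux.sg (σ i) * f (x i) - c| ≤ B := by
    rintro f ⟨m, a, h, hh, ha, hsum, rfl⟩
    have e : ∑ i, FatAux.sg (σ i) * (∑ j, a j * h j (x i)) - c
        = ∑ j, a j * (FatAux.ip σ (tr (h j)) - c) := by
      simp_rw [mul_sub]
      rw [Finset.sum_sub_distrib, ← Finset.sum_mul, hsum, one_mul]
      congr 1
      simp_rw [FatAux.ip, Finset.mul_sum]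
      rw [Finset.sum_comm]
      refine Finset.sum_congr rfl fun j _ => Finset.sum_congr rfl fun i _ => ?_
      rw [htrs (h j) (hh j) i]; ring
    rw [e]
    calc _ ≤ ∑ j, |a j * (FatAux.ip σ (tr (h j)) - c)| := Finset.abs_sum_le_sum_abs _ _
      _ ≤ ∑ j, a j * B := by
        refine Finset.sum_le_sum fun j _ => ?_
        rw [abs_mul, abs_of_pos (ha j)]
        exact mul_le_mul_of_nonneg_left (hσ _ (hVm _ (hh j))) (ha j).le
      _ = B := by rw [← Finset.sum_mul, hsum, one_mul]
  obtain ⟨f, hf, hfi⟩ := hunc σ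
  obtain ⟨g, hg, hgi⟩ := hunc (fun i => !(σ i))
  have h1 := abs_le.1 (hvote f hf)
  have h2 := abs_le.1 (hvote g hg)
  have h3 : (n:ℝ) * (2 * β) ≤ ∑ i, FatAux.sg (σ i) * f (x i) - ∑ i, FatAux.sg (σ i) * g (x i) := by
    rw [← Finset.sum_sub_distrib]
    calc (n:ℝ) * (2 * β) = ∑ i : Fin n, 2 * β := by simp
      _ ≤ _ := by
        refine Finset.sum_le_sum fun i _ => ?_
        have hfi' := hfi i
        have hgi' := hgi i
        cases hb : σ i
        · have := hfi'.2 hb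
          have := hgi'.1 (by simp [hb])
          simp [FatAux.sg]; linarith
        · have := hfi'.1 hb
          have := hgi'.2 (by simp [hb])
          simp [FatAux.sg]; linarith
  have h4 : (n:ℝ) * β ≤ B := by linarith
  have h5 : ((n:ℝ) * β) ^ 2 ≤ 1764 * (n * d) := by
    calc ((n:ℝ) * β) ^ 2 ≤ B ^ 2 := pow_le_pow_left₀ (by positivity) h4 2
      _ = _ := by rw [hB, mul_pow, Real.sq_sqrt (by positivity)]; norm_num
  rw [le_div_iff₀ (by positivity)]
  have h6 : (n:ℝ) * (n * β ^ 2) ≤ n * (1764 * d) := by nlinarith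
  exact le_of_mul_le_mul_left h6 hn'
end

section
/- Let Z ∈ (X × {-1,1})^{2m} be a fixed sequence of 2m labeled examples, f : X → [-1,1] a fixed function, θ > 0 a margin level, τ₁ ≥ 0 and 0 < δ < 1. Let S be a uniformly random subset of m of the 2m examples of Z, drawn without replacement, and S' = Z \ S. Then Pr[ L_S^θ(f) ≤ τ₁ and L_{S'}^θ(f) ≥ τ₁ + 32·(√(2τ₁·ln(e/δ)/m) + 2·ln(e/δ)/m) ] ≤ δ/e. -/
open MeasureTheory
open scoped ENNReal

/-- signed count -/
noncomputable def sgnSum {α : Type} [Fintype α] [DecidableEq α] (c : α → ℝ) (s : Finset α) : ℝ :=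
  ∑ x, c x * (if x ∈ s then -1 else 1)

lemma exists_perm_map {α : Type} [Fintype α] [DecidableEq α] (s t : Finset α)
    (h : s.card = t.card) : ∃ τ : Equiv.Perm α, s.map τ.toEmbedding = t := by
  have e : {x // x ∈ s} ≃ {x // x ∈ t} := Finset.equivOfCardEq h
  refine ⟨e.extendSubtype, ?_⟩
  apply Finset.eq_of_subset_of_card_le
  · intro y hy
    rw [Finset.mem_map] at hy
    obtain ⟨x, hx, rfl⟩ := hy
    exact e.extendSubtype_mem x hx
  · simp [h]

lemma sum_perm_eq {α : Type} [Fintype α] [DecidableEq α] (F : Finset α → ℝ) (s t : Finset α)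
    (h : s.card = t.card) :
    ∑ σ : Equiv.Perm α, F (s.map σ.toEmbedding) = ∑ σ : Equiv.Perm α, F (t.map σ.toEmbedding) := by
  obtain ⟨τ, rfl⟩ := exists_perm_map s t h
  rw [← Equiv.sum_comp (Equiv.mulRight τ)]
  refine Finset.sum_congr rfl fun σ _ => ?_
  congr 1
  rw [Finset.map_map]
  rfl

lemma sum_sets_map {α : Type} [Fintype α] [DecidableEq α] (F : Finset α → ℝ) (m : ℕ)
    (σ : Equiv.Perm α) :
    ∑ s ∈ Finset.univ.filter (fun s : Finset α => s.card = m), F (s.map σ.toEmbedding)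
      = ∑ s ∈ Finset.univ.filter (fun s : Finset α => s.card = m), F s := by
  refine Finset.sum_equiv σ.finsetCongr ?_ ?_
  · intro s; simp
  · intro s _; rfl

lemma avg_eq {α : Type} [Fintype α] [DecidableEq α] (F : Finset α → ℝ) (m : ℕ)
    (T : Finset α) (hT : T.card = m) :
    (Fintype.card (Equiv.Perm α) : ℝ) *
      ∑ s ∈ Finset.univ.filter (fun s : Finset α => s.card = m), F s
    = ((Finset.univ.filter (fun s : Finset α => s.card = m)).card : ℝ) *
      ∑ σ : Equiv.Perm α, F (T.map σ.toEmbedding) := by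
  have h1 : ∑ σ : Equiv.Perm α, ∑ s ∈ Finset.univ.filter (fun s : Finset α => s.card = m),
      F (s.map σ.toEmbedding) = (Fintype.card (Equiv.Perm α) : ℝ) *
      ∑ s ∈ Finset.univ.filter (fun s : Finset α => s.card = m), F s := by
    simp_rw [sum_sets_map]
    rw [Finset.sum_const, nsmul_eq_mul, Finset.card_univ]
  rw [← h1, Finset.sum_comm]
  rw [Finset.sum_congr rfl (g := fun _ => ∑ σ : Equiv.Perm α, F (T.map σ.toEmbedding))]
  · rw [Finset.sum_const, nsmul_eq_mul]
  · intro s hs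
    apply sum_perm_eq
    rw [hT]; simpa using hs

/-- transversal -/
def transv {m : ℕ} (ε : Fin m → Bool) : Finset (Fin m × Bool) :=
  Finset.univ.filter fun p => p.2 = ε p.1

lemma card_transv {m : ℕ} (ε : Fin m → Bool) : (transv ε).card = m := by
  have : transv ε = Finset.univ.map ⟨fun i : Fin m => (i, ε i), fun i j h => (Prod.ext_iff.1 h).1⟩ := by
    ext ⟨i, b⟩
    simp only [transv, Finset.mem_filter, Finset.mem_univ, true_and, Finset.mem_map,
      Function.Embedding.coeFn_mk, Prod.mk.injEq]
    constructor
    · intro h; exact ⟨i, Prod.ext rfl h.symm⟩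
    · rintro ⟨a, h⟩
      have h1 : a = i := congrArg Prod.fst h
      have h2 : ε a = b := congrArg Prod.snd h
      rw [← h2, h1]
  rw [this]; simp

lemma cosh_aux (l a b : ℝ) (ha : a = 0 ∨ a = 1) (hb : b = 0 ∨ b = 1) :
    Real.exp (l * (-a + b)) + Real.exp (l * (a - b)) ≤ 2 * Real.exp (l ^ 2 / 2 * (a + b)) := by
  have h := Real.cosh_le_exp_half_sq l
  rw [Real.cosh_eq] at h
  have h3 : 1 ≤ Real.exp (l ^ 2 / 2 * (1 + 1)) := Real.one_le_exp (by positivity)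
  rcases ha with rfl | rfl <;> rcases hb with rfl | rfl <;> norm_num at * <;> linarith

lemma sum_eps {α : Type} [Fintype α] [DecidableEq α] {m : ℕ} (e : Fin m × Bool ≃ α)
    (c : α → ℝ) (hc : ∀ x, c x = 0 ∨ c x = 1) (l : ℝ) :
    ∑ ε : Fin m → Bool, Real.exp (l * sgnSum c ((transv ε).map e.toEmbedding))
      ≤ 2 ^ m * Real.exp (l ^ 2 / 2 * ∑ x, c x) := by
  have h1 : ∀ ε : Fin m → Bool, Real.exp (l * sgnSum c ((transv ε).map e.toEmbedding))
      = ∏ i, Real.exp (l * (c (e (i, true)) * (if ε i = true then -1 else 1)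
          + c (e (i, false)) * (if ε i = true then 1 else -1))) := by
    intro ε
    rw [← Real.exp_sum, ← Finset.mul_sum]
    unfold sgnSum
    rw [← Equiv.sum_comp e, Fintype.sum_prod_type]
    congr 2
    refine Finset.sum_congr rfl fun i _ => ?_
    rw [Fintype.sum_bool]
    cases h : ε i <;> simp [transv, h]
  simp_rw [h1]
  have h2 := Finset.prod_univ_sum (fun _ : Fin m => (Finset.univ : Finset Bool))
    (fun i j => Real.exp (l * (c (e (i, true)) * (if j = true then -1 else 1)
          + c (e (i, false)) * (if j = true then 1 else -1))))
  rw [Fintype.piFinset_univ] at h2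
  rw [← h2, ← Equiv.sum_comp e, Fintype.sum_prod_type, Finset.mul_sum, Real.exp_sum]
  have h3 : (2 : ℝ) ^ m = ∏ _i : Fin m, 2 := by simp
  rw [h3, ← Finset.prod_mul_distrib]
  refine Finset.prod_le_prod (fun i _ => by positivity) fun i _ => ?_
  rw [Fintype.sum_bool, Fintype.sum_bool]
  have := cosh_aux l _ _ (hc (e (i, true))) (hc (e (i, false)))
  simpa [sub_eq_add_neg] using this

lemma mgf_bound {α : Type} [Fintype α] [DecidableEq α] {m : ℕ} (e : Fin m × Bool ≃ α)
    (c : α → ℝ) (hc : ∀ x, c x = 0 ∨ c x = 1) (l : ℝ) :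
    ∑ s ∈ Finset.univ.filter (fun s : Finset α => s.card = m), Real.exp (l * sgnSum c s)
      ≤ ((Finset.univ.filter (fun s : Finset α => s.card = m)).card : ℝ) *
        Real.exp (l ^ 2 / 2 * ∑ x, c x) := by
  set A := ∑ s ∈ Finset.univ.filter (fun s : Finset α => s.card = m), Real.exp (l * sgnSum c s)
  set N := ((Finset.univ.filter (fun s : Finset α => s.card = m)).card : ℝ)
  set P := (Fintype.card (Equiv.Perm α) : ℝ)
  have hP : 0 < P := by
    have : 0 < Fintype.card (Equiv.Perm α) := Fintype.card_pos
    exact Nat.cast_pos.2 this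
  have h1 : ∀ ε : Fin m → Bool, P * A = N * ∑ σ : Equiv.Perm α,
      Real.exp (l * sgnSum c ((transv ε).map (e.trans σ).toEmbedding)) := by
    intro ε
    have := avg_eq (fun s => Real.exp (l * sgnSum c s)) m ((transv ε).map e.toEmbedding)
      (by rw [Finset.card_map, card_transv])
    simp only [Finset.map_map] at this
    exact this
  have h2 : (2 : ℝ) ^ m * (P * A) = N * ∑ σ : Equiv.Perm α, ∑ ε : Fin m → Bool,
      Real.exp (l * sgnSum c ((transv ε).map (e.trans σ).toEmbedding)) := by
    rw [Finset.sum_comm]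
    have h0 : ∑ _ε : Fin m → Bool, P * A = (2 : ℝ) ^ m * (P * A) := by
      rw [Finset.sum_const, nsmul_eq_mul, Finset.card_univ]; simp
    rw [← h0, Finset.sum_congr rfl (fun ε _ => h1 ε), ← Finset.mul_sum]
  have h3 : ∑ σ : Equiv.Perm α, ∑ ε : Fin m → Bool,
      Real.exp (l * sgnSum c ((transv ε).map (e.trans σ).toEmbedding))
      ≤ P * (2 ^ m * Real.exp (l ^ 2 / 2 * ∑ x, c x)) := by
    refine (Finset.sum_le_sum fun σ _ => sum_eps (e.trans σ) c hc l).trans ?_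
    rw [Finset.sum_const, nsmul_eq_mul, Finset.card_univ]
  have h4 : (2 : ℝ) ^ m * (P * A) ≤ N * (P * (2 ^ m * Real.exp (l ^ 2 / 2 * ∑ x, c x))) := by
    rw [h2]; exact mul_le_mul_of_nonneg_left h3 (Nat.cast_nonneg _)
  have h5 : (0 : ℝ) < 2 ^ m * P := by positivity
  refine le_of_mul_le_mul_left ?_ h5
  calc _ = (2 : ℝ) ^ m * (P * A) := by ring
    _ ≤ _ := h4
    _ = _ := by ring

lemma key_ineq (a b L M τ : ℝ) (ha : 0 ≤ a) (hL : 0 < L) (hM : 0 < M)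
    (h1 : a / M ≤ τ) (h2 : b / M ≥ τ + 32 * (Real.sqrt (2 * τ * L / M) + 2 * L / M)) :
    0 < b - a ∧ 2 * L * (a + b) ≤ (b - a) ^ 2 := by
  have hτ : 0 ≤ τ := le_trans (by positivity) h1
  have haM : a ≤ τ * M := (div_le_iff₀ hM).1 h1
  set r := Real.sqrt (2 * τ * L / M) with hr
  have hr0 : 0 ≤ r := Real.sqrt_nonneg _
  have hr2 : r ^ 2 = 2 * τ * L / M := Real.sq_sqrt (by positivity)
  have hb : τ * M + 32 * (r * M + 2 * L) ≤ b := by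
    have := (le_div_iff₀ hM).1 h2
    have e : (τ + 32 * (r + 2 * L / M)) * M = τ * M + 32 * (r * M + 2 * L) := by
      field_simp
    linarith
  have hd : 32 * (r * M) + 64 * L ≤ b - a := by linarith
  have hrM : (r * M) ^ 2 = 2 * (τ * M) * L := by
    rw [mul_pow, hr2]; field_simp
  have hrM0 : 0 ≤ r * M := by positivity
  have h64 : 64 * L ≤ b - a := by linarith
  have h32 : 32 * (r * M) ≤ b - a := by linarith
  have p1 : 64 * L * (b - a) ≤ (b - a) ^ 2 := by nlinarith
  have p2 : (32 * (r * M)) ^ 2 ≤ (b - a) ^ 2 := pow_le_pow_left₀ (by positivity) h32 2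
  have p3 : a * L ≤ τ * M * L := mul_le_mul_of_nonneg_right haM hL.le
  have p4 : 0 ≤ a * L := by positivity
  refine ⟨by linarith, ?_⟩
  nlinarith

open scoped Classical in
lemma lossIdx_eq {X : Type} {k : ℕ} (Z : Fin k → X × ℝ) (s : Finset (Fin k))
    (θ : ℝ) (f : X → ℝ) :
    lossIdx Z s θ f = (∑ x, (if (Z x).2 * f (Z x).1 ≤ θ then (1:ℝ) else 0) *
      (if x ∈ s then 1 else 0)) / s.card := by
  unfold lossIdx
  congr 1
  rw [Nat.card_eq_fintype_card, Fintype.card_subtype, Finset.card_filter]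
  push_cast
  refine Finset.sum_congr rfl fun x _ => ?_
  by_cases h1 : x ∈ s <;> by_cases h2 : (Z x).2 * f (Z x).1 ≤ θ <;> simp [h1, h2]

open scoped Classical in
/-- Chernoff-without-replacement step for a fixed function on a fixed double
sample: the probability (over a uniformly random split of `Z` into `S` and `S' = Z \ S`
with `|S| = m`) that the loss on `S` is small while the loss on `S'` is large is at most
`δ/e`. -/
theorem stmt_11 (X : Type) (m : ℕ) (hm : 0 < m) (Z : Fin (2 * m) → X × ℝ)
    (f : X → ℝ) (hf : ∀ x, f x ∈ Set.Icc (-1 : ℝ) 1)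
    (θ : ℝ) (hθ : 0 < θ) (τ₁ : ℝ) (hτ₁ : 0 ≤ τ₁)
    (δ : ℝ) (hδ0 : 0 < δ) (hδ1 : δ < 1) :
    (((Finset.univ.filter fun s : Finset (Fin (2 * m)) => s.card = m).filter
        fun s =>
          lossIdx Z s θ f ≤ τ₁ ∧
          lossIdx Z sᶜ θ f ≥ τ₁ +
            32 * (Real.sqrt (2 * τ₁ * Real.log (Real.exp 1 / δ) / m) +
              2 * Real.log (Real.exp 1 / δ) / m)).card : ℝ) /
      ((Finset.univ.filter fun s : Finset (Fin (2 * m)) => s.card = m).card : ℝ)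
      ≤ δ / Real.exp 1 := by
  set L := Real.log (Real.exp 1 / δ) with hLdef
  have hq : 1 < Real.exp 1 / δ := by
    rw [lt_div_iff₀ hδ0]
    have := Real.add_one_lt_exp (x := 1) one_ne_zero
    linarith
  have hL : 0 < L := Real.log_pos hq
  have hEL : Real.exp (-L) = δ / Real.exp 1 := by
    rw [Real.exp_neg, hLdef, Real.exp_log (by linarith), inv_div]
  have hM : (0 : ℝ) < m := by exact_mod_cast hm
  set c : Fin (2 * m) → ℝ := fun x => if (Z x).2 * f (Z x).1 ≤ θ then (1:ℝ) else 0 with hcdef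
  have hc : ∀ x, c x = 0 ∨ c x = 1 := by
    intro x; by_cases h : (Z x).2 * f (Z x).1 ≤ θ <;> simp [hcdef, h]
  set K := ∑ x, c x with hK
  have e : Fin m × Bool ≃ Fin (2 * m) :=
    Fintype.equivOfCardEq (by simp [mul_comm])
  have hmgf := mgf_bound e c hc (Real.sqrt (2 * L / K))
  set U := Finset.univ.filter fun s : Finset (Fin (2 * m)) => s.card = m with hU
  set E := U.filter fun s =>
          lossIdx Z s θ f ≤ τ₁ ∧
          lossIdx Z sᶜ θ f ≥ τ₁ + 32 * (Real.sqrt (2 * τ₁ * L / m) + 2 * L / m) with hE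
  have hev : ∀ s ∈ E, 2 * L ≤ Real.sqrt (2 * L / K) * sgnSum c s ∧ 0 < K := by
    intro s hs
    rw [hE, Finset.mem_filter, hU, Finset.mem_filter] at hs
    obtain ⟨⟨-, hsc⟩, h1, h2⟩ := hs
    have hsc' : sᶜ.card = m := by
      rw [Finset.card_compl, hsc, Fintype.card_fin]; omega
    rw [lossIdx_eq, hsc] at h1
    rw [lossIdx_eq, hsc'] at h2
    have ha : 0 ≤ ∑ x, c x * (if x ∈ s then (1:ℝ) else 0) := by
      refine Finset.sum_nonneg fun x _ => ?_
      rcases hc x with h | h <;> rw [h] <;> split_ifs <;> norm_num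
    obtain ⟨k1, k2⟩ := key_ineq _ _ L m τ₁ ha hL hM h1 h2
    have hs1 : (∑ x, c x * (if x ∈ sᶜ then (1:ℝ) else 0)) - ∑ x, c x * (if x ∈ s then (1:ℝ) else 0)
        = sgnSum c s := by
      unfold sgnSum
      rw [← Finset.sum_sub_distrib]
      refine Finset.sum_congr rfl fun x _ => ?_
      by_cases h : x ∈ s <;> simp [h]
    have hs2 : (∑ x, c x * (if x ∈ s then (1:ℝ) else 0)) + ∑ x, c x * (if x ∈ sᶜ then (1:ℝ) else 0)
        = K := by
      rw [hK, ← Finset.sum_add_distrib]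
      refine Finset.sum_congr rfl fun x _ => ?_
      by_cases h : x ∈ s <;> simp [h]
    have hKpos : 0 < K := by rw [← hs2]; linarith
    have k1' : 0 < sgnSum c s := by rw [← hs1]; exact k1
    have k2' : 2 * L * K ≤ sgnSum c s ^ 2 := by rw [← hs1, ← hs2]; exact k2
    refine ⟨?_, hKpos⟩
    apply abs_le_of_sq_le_sq' _ (by positivity) |>.2
    rw [mul_pow (Real.sqrt _), Real.sq_sqrt (by positivity), div_mul_eq_mul_div, le_div_iff₀ hKpos]
    nlinarith
  by_cases hne : E = ∅
  · rw [hne]; simp; positivity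
  obtain ⟨s0, hs0⟩ := Finset.nonempty_iff_ne_empty.2 hne
  have hKpos := (hev s0 hs0).2
  have hsq : Real.sqrt (2 * L / K) ^ 2 / 2 * K = L := by
    rw [Real.sq_sqrt (by positivity)]; field_simp
  rw [hsq] at hmgf
  have hlow : (E.card : ℝ) * Real.exp (2 * L) ≤
      ∑ s ∈ U, Real.exp (Real.sqrt (2 * L / K) * sgnSum c s) := by
    rw [← nsmul_eq_mul, ← Finset.sum_const]
    refine (Finset.sum_le_sum fun s hs => Real.exp_le_exp.2 (hev s hs).1).trans ?_
    exact Finset.sum_le_sum_of_subset_of_nonneg (Finset.filter_subset _ _)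
      fun _ _ _ => (Real.exp_pos _).le
  have hUpos : (0 : ℝ) < U.card := by
    have : 0 < U.card := Finset.card_pos.2 ⟨s0, Finset.filter_subset _ _ hs0⟩
    exact_mod_cast this
  have hmgf' : ∑ s ∈ U, Real.exp (Real.sqrt (2 * L / K) * sgnSum c s) ≤ U.card * Real.exp L := by
    convert hmgf
  rw [← hEL, div_le_iff₀ hUpos]
  have h7 : (E.card : ℝ) * Real.exp (2 * L) ≤ Real.exp (-L) * U.card * Real.exp (2 * L) := by
    have : Real.exp (-L) * Real.exp (2 * L) = Real.exp L := by
      rw [← Real.exp_add]; congr 1; ring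
    calc _ ≤ U.card * Real.exp L := hlow.trans hmgf'
      _ = _ := by rw [← this]; ring
  exact le_of_mul_le_mul_right h7 (Real.exp_pos _)
end

section
/- Let m > 0, K > 0 and τ₁ ≥ 0 be real numbers, and let a, b ≥ 0 satisfy a ≤ τ₁ and b ≥ τ₁ + 32·(√(2·τ₁·K/m) + 2·K/m). Then a/2 + √(a·K/m) < b/2 − √(b·K/m). -/
open MeasureTheory
open scoped ENNReal

/-- the key algebraic implication. -/
theorem stmt_12 (m K τ₁ a b : ℝ) (hm : 0 < m) (hK : 0 < K) (hτ₁ : 0 ≤ τ₁)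
    (ha0 : 0 ≤ a) (hb0 : 0 ≤ b) (ha : a ≤ τ₁)
    (hb : b ≥ τ₁ + 32 * (Real.sqrt (2 * τ₁ * K / m) + 2 * K / m)) :
    a / 2 + Real.sqrt (a * K / m) < b / 2 - Real.sqrt (b * K / m) := by
  have hq : 0 < K / m := div_pos hK hm
  have hk : 0 < Real.sqrt (K / m) := Real.sqrt_pos.2 hq
  have e1 : Real.sqrt (a * K / m) = Real.sqrt a * Real.sqrt (K / m) := by
    rw [mul_div_assoc, Real.sqrt_mul ha0]
  have e2 : Real.sqrt (b * K / m) = Real.sqrt b * Real.sqrt (K / m) := by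
    rw [mul_div_assoc, Real.sqrt_mul hb0]
  have e3 : Real.sqrt τ₁ * Real.sqrt (K / m) ≤ Real.sqrt (2 * τ₁ * K / m) := by
    rw [← Real.sqrt_mul hτ₁]
    apply Real.sqrt_le_sqrt
    have : 0 ≤ τ₁ * (K / m) := mul_nonneg hτ₁ hq.le
    have h2 : 2 * τ₁ * K / m = 2 * (τ₁ * (K / m)) := by ring
    linarith
  have e4 : 2 * K / m = 2 * Real.sqrt (K / m) ^ 2 := by
    rw [Real.sq_sqrt hq.le]; ring
  have hat : Real.sqrt a ≤ Real.sqrt τ₁ := Real.sqrt_le_sqrt ha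
  have st := Real.sq_sqrt hτ₁
  have sb := Real.sq_sqrt hb0
  have ht := Real.sqrt_nonneg τ₁
  have hx := Real.sqrt_nonneg b
  rw [e1, e2]
  rw [e4] at hb
  generalize Real.sqrt (K / m) = k at *
  generalize Real.sqrt τ₁ = t at *
  generalize Real.sqrt b = x at *
  have hya : Real.sqrt a * k ≤ t * k := mul_le_mul_of_nonneg_right hat hk.le
  have htk : 0 ≤ t * k := mul_nonneg ht hk.le
  have hk2 : 0 < k ^ 2 := by positivity
  have hx4 : t + 4 * k ≤ x := by
    refine abs_le_of_sq_le_sq' ?_ hx |>.2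
    nlinarith
  have h5 : (t + 3 * k) ^ 2 ≤ (x - k) ^ 2 :=
    pow_le_pow_left₀ (by positivity) (by linarith) 2
  nlinarith
end

section
/- Let F be a nonempty class of functions X → [-1,1] and suppose F β-shatters points x₁,...,xₙ with witness levels r₁,...,rₙ ∈ ℝ for some β > 0. Then E_{σ uniform on {-1,1}^n}[ sup_{f∈F} (1/n)·∑_{i=1}^n σ_i·f(x_i) ] ≥ β. -/
open MeasureTheory
open scoped ENNReal

/-- β-shattering lower-bounds the Rademacher complexity. -/
theorem stmt_14 (X : Type) (F : Set (X → ℝ)) (hFne : F.Nonempty)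
    (hFb : ∀ f ∈ F, ∀ x, f x ∈ Set.Icc (-1 : ℝ) 1)
    (β : ℝ) (hβ : 0 < β) (n : ℕ) (hn : 0 < n) (x : Fin n → X) (r : Fin n → ℝ)
    (hshat : FatShattersWith F β x r) :
    β ≤ (∑ σ : Fin n → Bool,
          sSup {v : ℝ | ∃ f ∈ F,
            v = (1 / (n : ℝ)) * ∑ i, (if σ i then (1 : ℝ) else -1) * f (x i)}) / 2 ^ n := by
  have hnR : (0 : ℝ) < n := by exact_mod_cast hn
  have hpos : (0 : ℝ) < 1 / (n : ℝ) := by positivity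
  have key : ∀ σ : Fin n → Bool,
      β + (1 / (n : ℝ)) * ∑ i, (if σ i then (1 : ℝ) else -1) * r i ≤
      sSup {v : ℝ | ∃ f ∈ F,
            v = (1 / (n : ℝ)) * ∑ i, (if σ i then (1 : ℝ) else -1) * f (x i)} := by
    intro σ
    obtain ⟨f, hf, hfs⟩ := hshat σ
    have hbdd : BddAbove {v : ℝ | ∃ f ∈ F,
            v = (1 / (n : ℝ)) * ∑ i, (if σ i then (1 : ℝ) else -1) * f (x i)} := by
      refine ⟨(1 / (n : ℝ)) * ∑ i : Fin n, (1 : ℝ), ?_⟩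
      rintro v ⟨g, hg, rfl⟩
      refine mul_le_mul_of_nonneg_left (Finset.sum_le_sum fun i _ => ?_) hpos.le
      have h := hFb g hg (x i)
      split_ifs
      · linarith [h.2]
      · linarith [h.1]
    refine le_trans ?_ (le_csSup hbdd ⟨f, hf, rfl⟩)
    have h1 : β = (1 / (n : ℝ)) * ∑ i : Fin n, β := by
      simp
      field_simp
    have h2 : ∑ i : Fin n, β + ∑ i, (if σ i then (1 : ℝ) else -1) * r i ≤
        ∑ i, (if σ i then (1 : ℝ) else -1) * f (x i) := by
      rw [← Finset.sum_add_distrib]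
      refine Finset.sum_le_sum fun i _ => ?_
      have h := hfs i
      cases hb : σ i
      · have := h.2 hb
        simp
        linarith
      · have := h.1 hb
        simp
        linarith
    calc _ = (1 / (n : ℝ)) * (∑ i : Fin n, β + ∑ i, (if σ i then (1 : ℝ) else -1) * r i) := by
            rw [mul_add, ← h1]
      _ ≤ _ := mul_le_mul_of_nonneg_left h2 hpos.le
  have hzero : ∑ σ : Fin n → Bool, ∑ i, (if σ i then (1 : ℝ) else -1) * r i = 0 := by
    have hinv : Function.Involutive (fun (σ : Fin n → Bool) (i : Fin n) => !σ i) := by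
      intro σ
      funext i
      simp
    have h := Equiv.sum_comp (Function.Involutive.toPerm _ hinv)
      (fun σ : Fin n → Bool => ∑ i, (if σ i then (1 : ℝ) else -1) * r i)
    have h' : ∀ σ : Fin n → Bool,
        ∑ i, (if (Function.Involutive.toPerm _ hinv σ) i then (1 : ℝ) else -1) * r i
          = - ∑ i, (if σ i then (1 : ℝ) else -1) * r i := by
      intro σ
      rw [← Finset.sum_neg_distrib]
      refine Finset.sum_congr rfl fun i _ => ?_
      cases hb : σ i <;> simp [Function.Involutive.coe_toPerm, hb]
    simp only [h'] at h
    rw [Finset.sum_neg_distrib] at h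
    linarith
  rw [le_div_iff₀ (by positivity)]
  have hsum := Finset.sum_le_sum fun (σ : Fin n → Bool) (_ : σ ∈ Finset.univ) => key σ
  rw [Finset.sum_add_distrib, ← Finset.mul_sum, hzero, mul_zero, add_zero] at hsum
  refine le_trans (le_of_eq ?_) hsum
  simp [mul_comm]
end
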